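/- arXiv:1103.0995 — 3 statements merged into one kernel-verified Lean document; each statement's English description precedes it below -/
import Mathlib

section
/- Let A be a real m×n matrix of rank ρ and let k be an integer with 1 ≤ k < ρ. For every integer r with k < r ≤ n there exists a matrix C ∈ R^{m×r} whose columns are r columns of A such that ‖A − Π²_{C,k}(A)‖₂ ≤ (1 + (1 + √((ρ−k)/r)) / (1 − √(k/r))) · ‖A − A_k‖₂. -/
open Matrix MeasureTheory

noncomputable def frobSq {m n : Type*} [Fintype m] [Fintype n] (A : Matrix m n ℝ) : ℝ :=
  ∑ i, ∑ j, A i j ^ 2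

noncomputable def spec {m n : Type*} [Fintype m] [Fintype n] [DecidableEq n]
    (A : Matrix m n ℝ) : ℝ :=
  ‖LinearMap.toContinuousLinearMap (Matrix.toEuclideanLin A)‖

noncomputable def specErr {m n : Type*} [Fintype m] [Fintype n] [DecidableEq n]
    (A : Matrix m n ℝ) (k : ℕ) : ℝ :=
  sInf {e : ℝ | ∃ X : Matrix m n ℝ, X.rank ≤ k ∧ e = spec (A - X)}

noncomputable def frobSqErr {m n : Type*} [Fintype m] [Fintype n]
    (A : Matrix m n ℝ) (k : ℕ) : ℝ :=
  sInf {e : ℝ | ∃ X : Matrix m n ℝ, X.rank ≤ k ∧ e = frobSq (A - X)}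

noncomputable def specErrIn {m n r : Type*} [Fintype m] [Fintype n] [DecidableEq n]
    [Fintype r] (A : Matrix m n ℝ) (C : Matrix m r ℝ) (k : ℕ) : ℝ :=
  sInf {e : ℝ | ∃ X : Matrix m n ℝ, X.rank ≤ k ∧
    LinearMap.range X.mulVecLin ≤ LinearMap.range C.mulVecLin ∧ e = spec (A - X)}

noncomputable def frobSqErrIn {m n r : Type*} [Fintype m] [Fintype n] [Fintype r]
    (A : Matrix m n ℝ) (C : Matrix m r ℝ) (k : ℕ) : ℝ :=
  sInf {e : ℝ | ∃ X : Matrix m n ℝ, X.rank ≤ k ∧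
    LinearMap.range X.mulVecLin ≤ LinearMap.range C.mulVecLin ∧ e = frobSq (A - X)}

def IsMoorePenrose {m n : Type*} [Fintype m] [Fintype n]
    (M : Matrix m n ℝ) (P : Matrix n m ℝ) : Prop :=
  M * P * M = M ∧ P * M * P = P ∧ (M * P)ᵀ = M * P ∧ (P * M)ᵀ = P * M

set_option linter.unusedSectionVars false

namespace Matrix

section Barrier

variable {d ι : Type*} [Fintype d] [DecidableEq d] [Fintype ι]

lemma inv_eq_inv_add_of_eq_add_smul_one {X Y : Matrix d d ℝ} {δ : ℝ} (hX : IsUnit X)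
    (hY : IsUnit Y) (h : Y = X + δ • 1) :
    X⁻¹ = Y⁻¹ + δ • (Y⁻¹ * Y⁻¹) + δ ^ 2 • (Y⁻¹ * X⁻¹ * Y⁻¹) := by
  have hXd := (isUnit_iff_isUnit_det X).1 hX
  have hYd := (isUnit_iff_isUnit_det Y).1 hY
  have h1 : X⁻¹ = Y⁻¹ + δ • (Y⁻¹ * X⁻¹) := by
    have : Y⁻¹ * Y * X⁻¹ = Y⁻¹ * X * X⁻¹ + δ • (Y⁻¹ * X⁻¹) := by
      nth_rewrite 2 [h]
      simp [mul_add, add_mul]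
    rwa [nonsing_inv_mul _ hYd, one_mul, mul_assoc, mul_nonsing_inv _ hXd, mul_one] at this
  have h2 : X⁻¹ = Y⁻¹ + δ • (X⁻¹ * Y⁻¹) := by
    have : X⁻¹ * (Y * Y⁻¹) = X⁻¹ * X * Y⁻¹ + δ • (X⁻¹ * Y⁻¹) := by
      nth_rewrite 1 [h]
      simp [mul_add, add_mul, mul_assoc]
    rwa [mul_nonsing_inv _ hYd, mul_one, nonsing_inv_mul _ hXd, one_mul] at this
  have h3 : Y⁻¹ * X⁻¹ = Y⁻¹ * Y⁻¹ + δ • (Y⁻¹ * X⁻¹ * Y⁻¹) := by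
    nth_rewrite 1 [h2]
    simp [mul_add, mul_assoc]
  calc X⁻¹ = Y⁻¹ + δ • (Y⁻¹ * X⁻¹) := h1
    _ = _ := by nth_rewrite 1 [h3]; rw [smul_add, smul_smul, sq, add_assoc]

lemma PosSemidef.mul_mul_self {P H : Matrix d d ℝ} (hP : P.PosSemidef) (hH : H.IsHermitian) :
    (H * P * H).PosSemidef := by
  have := hP.conjTranspose_mul_mul_same H
  rwa [hH.eq] at this

lemma PosDef.mul_self {P : Matrix d d ℝ} (hP : P.PosDef) : (P * P).PosDef := by
  have := PosDef.conjTranspose_mul_self P (mulVec_injective_of_isUnit hP.isUnit)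
  rwa [hP.isHermitian.eq] at this

lemma trace_inv_add_vecMulVec {X : Matrix d d ℝ} (hX : IsUnit X) (hH : X.IsHermitian)
    {t : ℝ} {v : d → ℝ} (h : 1 + t * (v ⬝ᵥ X⁻¹ *ᵥ v) ≠ 0) :
    IsUnit (X + t • vecMulVec v v) ∧
    (X + t • vecMulVec v v)⁻¹.trace =
      X⁻¹.trace - t / (1 + t * (v ⬝ᵥ X⁻¹ *ᵥ v)) * (v ⬝ᵥ (X⁻¹ * X⁻¹) *ᵥ v) := by
  have hXd := (isUnit_iff_isUnit_det X).1 hX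
  set c := v ⬝ᵥ X⁻¹ *ᵥ v with hc
  have hs : X⁻¹ᵀ = X⁻¹ := by simpa using hH.inv.eq
  have hv : v ᵥ* X⁻¹ = X⁻¹ *ᵥ v := by rw [← mulVec_transpose, hs]
  have hmul : (X + t • vecMulVec v v) *
      (X⁻¹ - (t / (1 + t * c)) • vecMulVec (X⁻¹ *ᵥ v) (X⁻¹ *ᵥ v)) = 1 := by
    rw [mul_sub, add_mul, add_mul, mul_nonsing_inv _ hXd, smul_mul_assoc, vecMulVec_mul, hv,
      mul_smul_comm, mul_vecMulVec, mulVec_mulVec, mul_nonsing_inv _ hXd, one_mulVec,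
      smul_mul_assoc, mul_smul_comm, vecMulVec_mul_vecMulVec, ← hc, ← sub_eq_zero]
    ext i j
    simp [vecMulVec_apply]
    field_simp
    ring
  refine ⟨IsUnit.of_mul_eq_one _ hmul, ?_⟩
  rw [inv_eq_right_inv hmul, trace_sub, trace_smul, trace_vecMulVec, smul_eq_mul]
  congr 2
  rw [← mulVec_mulVec, dotProduct_mulVec v, hv]

lemma sum_dotProduct_mulVec_row {V : Matrix ι d ℝ} (hV : Vᵀ * V = 1) (Q : Matrix d d ℝ) :
    ∑ i, V i ⬝ᵥ Q *ᵥ V i = Q.trace := by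
  calc ∑ i, V i ⬝ᵥ Q *ᵥ V i = (V * (Q * Vᵀ)).trace := rfl
    _ = Q.trace := by rw [trace_mul_comm, Matrix.mul_assoc, hV, Matrix.mul_one]

lemma PosSemidef.trace_smul_one_sub {P : Matrix d d ℝ} (hP : P.PosSemidef) :
    (P.trace • (1 : Matrix d d ℝ) - P).PosSemidef := by
  have hdiag : (diagonal fun i => P.trace - hP.1.eigenvalues i).PosSemidef := by
    refine PosSemidef.diagonal fun i => ?_
    have := hP.1.trace_eq_sum_eigenvalues
    simp only [RCLike.ofReal_real_eq_id, id] at this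
    simpa [this] using Finset.single_le_sum (fun j _ => hP.eigenvalues_nonneg j)
      (Finset.mem_univ i)
  have key := hdiag.mul_mul_conjTranspose_same (hP.1.eigenvectorUnitary : Matrix d d ℝ)
  convert key using 1
  have h1 : (diagonal fun i => P.trace - hP.1.eigenvalues i) =
      P.trace • (1 : Matrix d d ℝ) - diagonal hP.1.eigenvalues := by
    ext i j
    by_cases h : i = j <;> simp [h]
  have h2 := hP.1.spectral_theorem
  rw [Unitary.conjStarAlgAut_apply] at h2
  have h3 : (hP.1.eigenvectorUnitary : Matrix d d ℝ) *
      (hP.1.eigenvectorUnitary : Matrix d d ℝ)ᴴ = 1 :=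
    Unitary.coe_mul_star_self _
  rw [h1, mul_sub, sub_mul, mul_smul_comm, smul_mul_assoc, mul_one, h3]
  congr 1

lemma PosDef.sub_one_of_trace_inv_lt_one {M : Matrix d d ℝ} (hM : M.PosDef)
    (ht : M⁻¹.trace < 1) : (M - 1).PosDef := by
  have hd := (isUnit_iff_isUnit_det M).1 hM.isUnit
  have h1 : (1 - M⁻¹).PosDef := by
    have := (PosDef.one (n := d) (R := ℝ)).smul (sub_pos.2 ht)
    have := this.add_posSemidef hM.inv.posSemidef.trace_smul_one_sub
    convert this using 1
    module
  have h2 := h1.add_posSemidef (hM.posSemidef.mul_mul_self h1.isHermitian)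
  convert h2 using 1
  rw [sub_mul, sub_mul, mul_sub, mul_sub, nonsing_inv_mul _ hd, one_mul, mul_one, mul_one, one_mul,
    mul_nonsing_inv _ hd]
  abel

/-- Raising the lower barrier by `1`, the total gain over an isotropic family of vectors is at
least `1 - tr M⁻¹`. -/
lemma lower_barrier [Nonempty d] {M : Matrix d d ℝ} (hM : (M - 1).PosDef) (hM0 : M.PosDef)
    (ht : M⁻¹.trace ≤ 1) :
    0 < (M - 1)⁻¹.trace - M⁻¹.trace ∧
    1 - M⁻¹.trace ≤ ((M - 1)⁻¹ * (M - 1)⁻¹).trace / ((M - 1)⁻¹.trace - M⁻¹.trace)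
      - (M - 1)⁻¹.trace := by
  set Q := (M - 1)⁻¹ with hQ
  have hQp : Q.PosDef := hM.inv
  have hip : M⁻¹.PosDef := hM0.inv
  have e1 := congrArg trace (inv_eq_inv_add_of_eq_add_smul_one (δ := 1) hM.isUnit hM0.isUnit
    (by simp))
  have e2 := congrArg trace (inv_eq_inv_add_of_eq_add_smul_one (δ := -1) hM0.isUnit hM.isUnit
    (by simp [sub_eq_add_neg]))
  simp only [trace_add, trace_smul, smul_eq_mul, ← hQ] at e1 e2
  have p1 := hip.mul_self.trace_pos
  have p2 := (hQp.posSemidef.mul_mul_self hip.isHermitian).trace_nonneg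
  set Δ := Q.trace - M⁻¹.trace with hΔ
  have hpos : 0 < Δ := by linarith
  refine ⟨hpos, ?_⟩
  have cs := (hip.posSemidef.mul_mul_self
    (H := Q - Δ • 1)
    (hQp.isHermitian.sub (isHermitian_one.smul (by simp [IsSelfAdjoint])))).trace_nonneg
  have cs' : (Q - Δ • 1) * M⁻¹ * (Q - Δ • 1) =
      Q * M⁻¹ * Q - Δ • (Q * M⁻¹) - Δ • (M⁻¹ * Q) + (Δ * Δ) • M⁻¹ := by
    simp only [sub_mul, mul_sub, smul_mul_assoc, mul_smul_comm, one_mul, mul_one, smul_sub,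
      smul_smul]
    abel
  have hd := (isUnit_iff_isUnit_det M).1 hM0.isUnit
  have hd' := (isUnit_iff_isUnit_det _).1 hM.isUnit
  have e3 : Q * M⁻¹ = Q - M⁻¹ := by
    have : Q * (M - (M - 1)) * M⁻¹ = Q - M⁻¹ := by
      rw [mul_sub, sub_mul, mul_assoc, mul_nonsing_inv _ hd, mul_one, hQ, nonsing_inv_mul _ hd',
        one_mul]
    simpa using this
  have e4 : (Q * M⁻¹).trace = Δ := by rw [e3, trace_sub]
  rw [cs', trace_add, trace_sub, trace_sub, trace_smul, trace_smul, trace_smul,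
    trace_mul_comm M⁻¹ Q, e4] at cs
  simp only [smul_eq_mul] at cs
  rw [le_sub_iff_add_le, le_div_iff₀ hpos]
  nlinarith [mul_nonneg (mul_nonneg hpos.le hpos.le) (sub_nonneg.2 ht)]

/-- Raising the upper barrier by `δ`, the total cost over an isotropic family of vectors is at
most `δ⁻¹ + tr N⁻¹`. -/
lemma upper_barrier [Nonempty d] {N : Matrix d d ℝ} {δ : ℝ} (hδ : 0 < δ) (hN : N.PosDef) :
    (N + δ • 1).PosDef ∧ 0 < N⁻¹.trace - (N + δ • 1)⁻¹.trace ∧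
    ((N + δ • 1)⁻¹ * (N + δ • 1)⁻¹).trace / (N⁻¹.trace - (N + δ • 1)⁻¹.trace)
      + (N + δ • 1)⁻¹.trace ≤ δ⁻¹ + N⁻¹.trace := by
  have hN' : (N + δ • 1).PosDef := hN.add_posSemidef (PosSemidef.one.smul hδ.le)
  have e1 := congrArg trace (inv_eq_inv_add_of_eq_add_smul_one hN.isUnit hN'.isUnit rfl)
  simp only [trace_add, trace_smul, smul_eq_mul] at e1
  have p1 := hN'.inv.mul_self.trace_pos
  have p2 := (hN.inv.posSemidef.mul_mul_self hN'.inv.isHermitian).trace_nonneg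
  set R := (N + δ • 1)⁻¹
  have hpos : 0 < N⁻¹.trace - R.trace := by
    rw [e1]
    nlinarith [mul_pos hδ p1, mul_nonneg (sq_nonneg δ) p2]
  refine ⟨hN', hpos, add_le_add ?_ (by linarith)⟩
  rw [div_le_iff₀ hpos, inv_mul_eq_div, le_div_iff₀ hδ]
  nlinarith [mul_nonneg (sq_nonneg δ) p2]

lemma PosDef.sub_smul_vecMulVec {X : Matrix d d ℝ} (hX : X.PosDef) {t : ℝ} (ht : 0 ≤ t)
    {u : d → ℝ} (h : t * (u ⬝ᵥ X⁻¹ *ᵥ u) < 1) : (X - t • vecMulVec u u).PosDef := by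
  set c := u ⬝ᵥ X⁻¹ *ᵥ u with hc
  have hd := (isUnit_iff_isUnit_det X).1 hX.isUnit
  have hs : X⁻¹ᵀ = X⁻¹ := by simpa using hX.isHermitian.inv.eq
  have hv : u ᵥ* X⁻¹ = X⁻¹ *ᵥ u := by rw [← mulVec_transpose, hs]
  have hu : IsUnit (X - t • vecMulVec u u) := by
    have := (trace_inv_add_vecMulVec (t := -t) (v := u) hX.isUnit hX.isHermitian
      (by rw [← hc]; linarith)).1
    simpa [sub_eq_add_neg] using this
  have hE : (vecMulVec u u).PosSemidef := by simpa using posSemidef_vecMulVec_self_star u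
  have h1 := (hX.posSemidef.mul_mul_conjTranspose_same (1 - t • vecMulVec u (X⁻¹ *ᵥ u))).add
    (hE.smul (mul_nonneg ht (sub_pos.2 h).le))
  have h2 : (X - t • vecMulVec u u).PosSemidef := by
    convert h1 using 1
    rw [conjTranspose_sub, conjTranspose_smul, conjTranspose_one]
    simp only [conjTranspose_eq_transpose_of_trivial, transpose_vecMulVec, star_trivial]
    rw [sub_mul, one_mul, mul_sub, mul_one, sub_mul, smul_mul_assoc, vecMulVec_mul, mul_smul_comm,
      mul_vecMulVec, mulVec_mulVec, mul_nonsing_inv _ hd, one_mulVec, smul_mul_assoc,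
      mul_smul_comm, vecMulVec_mul_vecMulVec, ← hv, vecMul_vecMul, nonsing_inv_mul _ hd,
      vecMul_one, hc, ← hv]
    ext i j
    simp [vecMulVec_apply]
    ring
  exact h2.posDef_iff_isUnit.2 hu

lemma exists_pos_and_le_of_sum_le_sum {f g : ι → ℝ} (hf : ∀ i, 0 ≤ f i)
    (h : ∑ i, f i ≤ ∑ i, g i) (hg : 0 < ∑ i, g i) : ∃ i, 0 < g i ∧ f i ≤ g i := by
  by_contra! hcon
  have hle : ∀ i, g i ≤ f i := fun i => by
    rcases le_or_gt (g i) 0 with h0 | h0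
    · exact h0.trans (hf i)
    · exact (hcon i h0).le
  have heq := (Finset.sum_eq_sum_iff_of_le fun i _ => hle i).1
    (le_antisymm (Finset.sum_le_sum fun i _ => hle i) h)
  refine hg.not_ge (Finset.sum_nonpos fun i hi => ?_)
  by_contra! h0
  exact (hcon i h0).ne (heq i hi)

variable {e : Type*} [Fintype e] [DecidableEq e]

lemma exists_barrier_step [Nonempty d] [Nonempty e] {V : Matrix ι d ℝ} {U : Matrix ι e ℝ}
    (hV : Vᵀ * V = 1) (hU : Uᵀ * U = 1) {δ ε φ : ℝ} (hδ : 0 < δ) (hε : ε < 1)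
    (hφ : δ⁻¹ + φ ≤ 1 - ε) {M : Matrix d d ℝ} {N : Matrix e e ℝ}
    (hM : M.PosDef) (hMt : M⁻¹.trace ≤ ε) (hN : N.PosDef) (hNt : N⁻¹.trace ≤ φ) :
    ∃ (j : ι) (t : ℝ), 0 ≤ t ∧
      (M - 1 + t • vecMulVec (V j) (V j)).PosDef ∧
      (M - 1 + t • vecMulVec (V j) (V j))⁻¹.trace ≤ ε ∧
      (N + δ • 1 - t • vecMulVec (U j) (U j)).PosDef ∧
      (N + δ • 1 - t • vecMulVec (U j) (U j))⁻¹.trace ≤ φ := by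
  have hM' := hM.sub_one_of_trace_inv_lt_one (hMt.trans_lt hε)
  obtain ⟨hΔ, hlow⟩ := lower_barrier hM' hM (hMt.trans hε.le)
  obtain ⟨hN', hD, hup⟩ := upper_barrier hδ hN
  set Δ := (M - 1)⁻¹.trace - M⁻¹.trace with hΔdef
  set D := N⁻¹.trace - (N + δ • 1)⁻¹.trace with hDdef
  set Q := (M - 1)⁻¹ with hQ
  set R := (N + δ • 1)⁻¹ with hR
  have hR1 : ∀ i, 0 ≤ U i ⬝ᵥ R *ᵥ U i := fun i => by
    simpa using hN'.inv.posSemidef.dotProduct_mulVec_nonneg (U i)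
  have hR2 : ∀ i, 0 ≤ U i ⬝ᵥ (R * R) *ᵥ U i := fun i => by
    simpa using hN'.inv.mul_self.posSemidef.dotProduct_mulVec_nonneg (U i)
  have hQ1 : ∀ i, 0 ≤ V i ⬝ᵥ Q *ᵥ V i := fun i => by
    simpa using hM'.inv.posSemidef.dotProduct_mulVec_nonneg (V i)
  obtain ⟨j, hj0, hj⟩ := exists_pos_and_le_of_sum_le_sum
    (f := fun i => (U i ⬝ᵥ (R * R) *ᵥ U i) / D + U i ⬝ᵥ R *ᵥ U i)
    (g := fun i => (V i ⬝ᵥ (Q * Q) *ᵥ V i) / Δ - V i ⬝ᵥ Q *ᵥ V i)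
    (fun i => add_nonneg (div_nonneg (hR2 i) hD.le) (hR1 i))
    (by
      rw [Finset.sum_add_distrib, Finset.sum_sub_distrib, ← Finset.sum_div, ← Finset.sum_div]
      simp only [sum_dotProduct_mulVec_row hV, sum_dotProduct_mulVec_row hU]
      linarith)
    (by
      rw [Finset.sum_sub_distrib, ← Finset.sum_div]
      simp only [sum_dotProduct_mulVec_row hV]
      linarith)
  set g := (V j ⬝ᵥ (Q * Q) *ᵥ V j) / Δ - V j ⬝ᵥ Q *ᵥ V j with hg
  have hg1 : V j ⬝ᵥ (Q * Q) *ᵥ V j = (g + V j ⬝ᵥ Q *ᵥ V j) * Δ := by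
    rw [hg]; field_simp; ring
  have hinv : (0 : ℝ) < g⁻¹ := inv_pos.2 hj0
  have hu : g⁻¹ * (U j ⬝ᵥ R *ᵥ U j) < 1 := by
    rw [inv_mul_lt_iff₀ hj0, mul_one]
    rcases (hR2 j).eq_or_lt with h0 | h0
    · have : U j = 0 := by
        by_contra hne
        exact (hN'.inv.mul_self.dotProduct_mulVec_pos hne).ne (by simpa using h0)
      simpa [this] using hj0
    · linarith [div_pos h0 hD]
  have hvE : (vecMulVec (V j) (V j)).PosSemidef := by
    simpa using posSemidef_vecMulVec_self_star (V j)
  refine ⟨j, g⁻¹, hinv.le, hM'.add_posSemidef (hvE.smul hinv.le), ?_,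
    hN'.sub_smul_vecMulVec hinv.le hu, ?_⟩
  · rw [(trace_inv_add_vecMulVec hM'.isUnit hM'.isHermitian
      (by rw [← hQ]; nlinarith [mul_nonneg hinv.le (hQ1 j)])).2, ← hQ, hg1]
    have hgq : g + V j ⬝ᵥ Q *ᵥ V j ≠ 0 := by linarith [hQ1 j]
    have : g⁻¹ / (1 + g⁻¹ * (V j ⬝ᵥ Q *ᵥ V j)) * ((g + V j ⬝ᵥ Q *ᵥ V j) * Δ) = Δ := by
      field_simp
    rw [this]
    linarith
  · have h1 := (trace_inv_add_vecMulVec (t := -g⁻¹) (v := U j) hN'.isUnit hN'.isHermitian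
      (by rw [← hR]; linarith)).2
    rw [neg_smul, ← sub_eq_add_neg, ← hR] at h1
    rw [h1]
    have hpos : 0 < g - U j ⬝ᵥ R *ᵥ U j := by
      rw [inv_mul_lt_iff₀ hj0, mul_one] at hu; linarith
    have h2 : -g⁻¹ / (1 + -g⁻¹ * (U j ⬝ᵥ R *ᵥ U j)) = -(g - U j ⬝ᵥ R *ᵥ U j)⁻¹ := by
      have : 1 + -g⁻¹ * (U j ⬝ᵥ R *ᵥ U j) = g⁻¹ * (g - U j ⬝ᵥ R *ᵥ U j) := by field_simp; ring
      rw [this]; field_simp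
    have h3 : (g - U j ⬝ᵥ R *ᵥ U j)⁻¹ * (U j ⬝ᵥ (R * R) *ᵥ U j) ≤ D := by
      rw [inv_mul_le_iff₀ hpos, ← div_le_iff₀ hD]
      linarith
    rw [h2]
    linarith

lemma transpose_mul_diagonal_add_single_mul [DecidableEq ι] (V : Matrix ι d ℝ) (s : ι → ℝ)
    (j : ι) (t : ℝ) :
    Vᵀ * diagonal (s + Pi.single j t) * V =
      Vᵀ * diagonal s * V + t • vecMulVec (V j) (V j) := by
  rw [Pi.add_def, ← diagonal_add, Matrix.mul_add, Matrix.add_mul]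
  congr 1
  ext a b
  rw [mul_apply, smul_apply, vecMulVec_apply, smul_eq_mul, Finset.sum_eq_single j]
  · rw [mul_diagonal, transpose_apply, Pi.single_eq_same]
    ring
  · intro i _ hi
    rw [mul_diagonal, Pi.single_eq_of_ne hi, mul_zero, zero_mul]
  · simp

lemma trace_inv_smul_one {c : ℝ} (hc : 0 < c) :
    ((c • (1 : Matrix d d ℝ))⁻¹).trace = Fintype.card d / c := by
  rw [inv_eq_right_inv (B := c⁻¹ • 1) (by simp [smul_smul, hc.ne'])]
  simp [div_eq_inv_mul]

/-- Dual set spectral sparsification: `r` nonnegative weights bounding one Gram matrix from below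
and another from above. -/
lemma exists_sparse_weights [DecidableEq ι] [Nonempty d] [Nonempty e] {V : Matrix ι d ℝ}
    {U : Matrix ι e ℝ} (hV : Vᵀ * V = 1) (hU : Uᵀ * U = 1) {δ ε φ p q : ℝ} (hδ : 0 < δ)
    (hε : ε < 1) (hφ : δ⁻¹ + φ ≤ 1 - ε) (hp : 0 < p) (hpε : Fintype.card d / p ≤ ε)
    (hq : 0 < q) (hqφ : Fintype.card e / q ≤ φ) (r : ℕ) :
    ∃ (s : ι → ℝ) (T : Finset ι), (∀ i, 0 ≤ s i) ∧ T.card ≤ r ∧ (∀ i ∉ T, s i = 0) ∧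
      (Vᵀ * diagonal s * V - (r - p) • 1).PosDef ∧
      (Vᵀ * diagonal s * V - (r - p) • 1)⁻¹.trace ≤ ε ∧
      ((q + δ * r) • 1 - Uᵀ * diagonal s * U).PosDef ∧
      ((q + δ * r) • 1 - Uᵀ * diagonal s * U)⁻¹.trace ≤ φ := by
  induction r with
  | zero =>
    refine ⟨0, ∅, by simp, by simp, by simp, ?_⟩
    simp only [Pi.zero_def, diagonal_zero, Matrix.mul_zero, Matrix.zero_mul, Nat.cast_zero,
      zero_sub, neg_smul, neg_neg, mul_zero, add_zero, sub_zero, trace_inv_smul_one hp,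
      trace_inv_smul_one hq]
    exact ⟨PosDef.one.smul hp, hpε, PosDef.one.smul hq, hqφ⟩
  | succ r ih =>
    obtain ⟨s, T, hs, hT, hsT, h1, h2, h3, h4⟩ := ih
    obtain ⟨j, t, ht, k1, k2, k3, k4⟩ := exists_barrier_step hV hU hδ hε hφ h1 h2 h3 h4
    have hM : Vᵀ * diagonal (s + Pi.single j t) * V - (((r + 1 : ℕ) : ℝ) - p) • 1 =
        Vᵀ * diagonal s * V - ((r : ℝ) - p) • 1 - 1 + t • vecMulVec (V j) (V j) := by
      rw [transpose_mul_diagonal_add_single_mul]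
      push_cast
      module
    have hN : (q + δ * ((r + 1 : ℕ) : ℝ)) • 1 - Uᵀ * diagonal (s + Pi.single j t) * U =
        (q + δ * r) • 1 - Uᵀ * diagonal s * U + δ • 1 - t • vecMulVec (U j) (U j) := by
      rw [transpose_mul_diagonal_add_single_mul]
      push_cast
      module
    refine ⟨s + Pi.single j t, insert j T, fun i => add_nonneg (hs i) ?_,
      (Finset.card_insert_le _ _).trans (by omega), fun i hi => ?_, ?_⟩
    · by_cases h : i = j <;> simp [h, ht]
    · rw [Finset.mem_insert, not_or] at hi
      simp [hsT i hi.2, hi.1]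
    · rw [hM, hN]
      exact ⟨k1, k2, k3, k4⟩

end Barrier

section Spectral

open scoped Matrix.Norms.L2Operator

section

variable {m n l : Type*} [Fintype m] [Fintype n] [Fintype l]

lemma norm_toLp_sq (v : m → ℝ) : ‖WithLp.toLp 2 v‖ ^ 2 = v ⬝ᵥ v := by
  rw [EuclideanSpace.norm_sq_eq]
  simp [dotProduct, sq]

lemma mulVec_dotProduct_mulVec_self (B : Matrix m n ℝ) (x : n → ℝ) :
    (B *ᵥ x) ⬝ᵥ (B *ᵥ x) = x ⬝ᵥ (Bᵀ * B) *ᵥ x := by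
  rw [← mulVec_mulVec, dotProduct_mulVec x, vecMul_transpose]

lemma mulVec_eq_submatrix_mulVec_comp (A : Matrix m n ℝ) {f : l → n}
    (hf : Function.Injective f) {y : n → ℝ} (hy : ∀ i ∉ Set.range f, y i = 0) :
    A *ᵥ y = A.submatrix id f *ᵥ (y ∘ f) := by
  ext a
  symm
  exact Finset.sum_of_injOn f hf.injOn (by simp) (fun i _ hi => by simp [hy i (by simpa using hi)])
    (by simp)

variable [DecidableEq n]

lemma l2_opNorm_le_of_posSemidef {B : Matrix m n ℝ} {c : ℝ} (hc : 0 ≤ c)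
    (h : (c ^ 2 • 1 - Bᵀ * B).PosSemidef) : ‖B‖ ≤ c := by
  rw [l2_opNorm_def]
  refine ContinuousLinearMap.opNorm_le_bound _ hc fun x => ?_
  refine le_of_sq_le_sq ?_ (by positivity)
  have key := h.dotProduct_mulVec_nonneg (WithLp.ofLp x)
  simp only [star_trivial, sub_mulVec, smul_mulVec, one_mulVec, dotProduct_sub, dotProduct_smul,
    smul_eq_mul] at key
  rw [← mulVec_dotProduct_mulVec_self, ← norm_toLp_sq, ← norm_toLp_sq] at key
  rw [mul_pow]
  exact sub_nonneg.1 key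

lemma mulVec_dotProduct_mulVec_self_le (B : Matrix m n ℝ) (x : n → ℝ) :
    (B *ᵥ x) ⬝ᵥ (B *ᵥ x) ≤ ‖B‖ ^ 2 * (x ⬝ᵥ x) := by
  have := pow_le_pow_left₀ (norm_nonneg _) (l2_opNorm_mulVec B (WithLp.toLp 2 x)) 2
  rw [mul_pow] at this
  rw [← norm_toLp_sq, ← norm_toLp_sq]
  exact this

lemma l2_opNorm_le_one {B : Matrix m n ℝ} (h : Bᵀ * B = 1) : ‖B‖ ≤ 1 :=
  l2_opNorm_le_of_posSemidef zero_le_one (by simpa [h] using PosSemidef.zero)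

lemma l2_opNorm_transpose [DecidableEq m] (B : Matrix m n ℝ) : ‖Bᵀ‖ = ‖B‖ := by
  rw [← conjTranspose_eq_transpose_of_trivial, l2_opNorm_conjTranspose]

lemma spec_eq_l2_opNorm (A : Matrix m n ℝ) : spec A = ‖A‖ := rfl

lemma posSemidef_smul_one_sub_inv {G : Matrix n n ℝ} {a : ℝ} (ha : 0 < a)
    (h : (G - a • 1).PosDef) : (a⁻¹ • 1 - G⁻¹).PosSemidef := by
  have hG : G.PosDef := by simpa using h.add (PosDef.one.smul ha)
  have hd := (isUnit_iff_isUnit_det G).1 hG.isUnit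
  have h1 := ((h.mul_self.posSemidef.add (h.posSemidef.smul ha.le)).mul_mul_self
    hG.inv.isHermitian).smul (inv_nonneg.2 ha.le)
  convert h1 using 1
  have : (G - a • 1) * (G - a • 1) + a • (G - a • 1) = G * G - a • G := by
    simp only [sub_mul, mul_sub, smul_mul_assoc, mul_smul_comm, one_mul, mul_one, smul_sub]
    abel
  rw [this, mul_sub, sub_mul, ← mul_assoc, mul_smul_comm, nonsing_inv_mul _ hd, one_mul,
    mul_nonsing_inv _ hd, smul_mul_assoc, one_mul, smul_sub, smul_smul, inv_mul_cancel₀ ha.ne',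
    one_smul]

/-- The rank-`k` matrix `A D V (Vᵀ D V)⁻¹ Vᵀ` approximates `A` whenever the weights `s` control the
Gram matrices of `V` and `U`. -/
lemma exists_approx_of_weights [DecidableEq m] [DecidableEq l] {d e : Type*} [Fintype d]
    [DecidableEq d] [Fintype e] [DecidableEq e] (A : Matrix m n ℝ) {V : Matrix n d ℝ}
    {U : Matrix n e ℝ} (hV : Vᵀ * V = 1) (hU : Uᵀ * U = 1)
    (hA : A = A * V * Vᵀ + A * U * Uᵀ) {s : n → ℝ} (hs : ∀ i, 0 ≤ s i) {f : l → n}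
    (hf : Function.Injective f) (hsf : ∀ i ∉ Set.range f, s i = 0) {a c : ℝ} (ha : 0 < a)
    (hc : 0 ≤ c) (hVs : (Vᵀ * diagonal s * V - a • 1).PosDef)
    (hUs : ((c ^ 2 * a) • 1 - Uᵀ * diagonal s * U).PosSemidef) :
    ∃ X : Matrix m n ℝ, X.rank ≤ Fintype.card d ∧
      LinearMap.range X.mulVecLin ≤ LinearMap.range (A.submatrix id f).mulVecLin ∧
      ‖A - X‖ ≤ (1 + c) * ‖A * U‖ := by
  set G := Vᵀ * diagonal s * V with hG
  have hGp : G.PosDef := by simpa using hVs.add (PosDef.one.smul ha)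
  have hd := (isUnit_iff_isUnit_det G).1 hGp.isUnit
  have hGs : G⁻¹ᵀ = G⁻¹ := by simpa using hGp.isHermitian.inv.eq
  set S := diagonal fun i => √(s i) with hS
  have hSt : Sᵀ = S := diagonal_transpose _
  have hSS : S * S = diagonal s := by
    rw [hS, diagonal_mul_diagonal]
    simp [Real.mul_self_sqrt (hs _)]
  refine ⟨A * (diagonal s * (V * G⁻¹ * Vᵀ)), ?_, ?_, ?_⟩
  · rw [← Matrix.mul_assoc, ← Matrix.mul_assoc]
    exact (rank_mul_le_right _ _).trans (rank_le_card_height _)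
  · rintro _ ⟨x, rfl⟩
    refine ⟨((diagonal s * (V * G⁻¹ * Vᵀ)) *ᵥ x) ∘ f, ?_⟩
    rw [mulVecLin_apply, mulVecLin_apply, ← mulVec_mulVec x A]
    refine (mulVec_eq_submatrix_mulVec_comp A hf fun i hi => ?_).symm
    rw [← mulVec_mulVec, mulVec_diagonal, hsf i hi, zero_mul]
  · have hX : A - A * (diagonal s * (V * G⁻¹ * Vᵀ)) =
        A * U * (Uᵀ - (S * U)ᵀ * (S * V * G⁻¹) * Vᵀ) := by
      have h1 : A * V * Vᵀ * (diagonal s * (V * G⁻¹ * Vᵀ)) = A * V * Vᵀ := by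
        calc _ = A * V * (G * G⁻¹) * Vᵀ := by simp only [hG, Matrix.mul_assoc]
          _ = _ := by rw [mul_nonsing_inv _ hd, Matrix.mul_one]
      have h2 : (S * U)ᵀ * (S * V * G⁻¹) * Vᵀ = Uᵀ * (diagonal s * (V * G⁻¹ * Vᵀ)) := by
        rw [← hSS, transpose_mul, hSt]
        simp only [Matrix.mul_assoc]
      rw [h2, Matrix.mul_sub]
      nth_rewrite 1 2 [hA]
      rw [Matrix.add_mul, h1, ← Matrix.mul_assoc (A * U)]
      abel
    have n1 : ‖Uᵀ‖ ≤ 1 := (l2_opNorm_transpose U).trans_le (l2_opNorm_le_one hU)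
    have n2 : ‖Vᵀ‖ ≤ 1 := (l2_opNorm_transpose V).trans_le (l2_opNorm_le_one hV)
    have n3 : ‖(S * U)ᵀ‖ ≤ c * √a := by
      rw [l2_opNorm_transpose]
      refine l2_opNorm_le_of_posSemidef (by positivity) ?_
      rw [mul_pow, Real.sq_sqrt ha.le]
      convert hUs using 2
      rw [transpose_mul, hSt, ← hSS]
      simp only [Matrix.mul_assoc]
    have n4 : ‖S * V * G⁻¹‖ ≤ (√a)⁻¹ := by
      refine l2_opNorm_le_of_posSemidef (by positivity) ?_
      rw [inv_pow, Real.sq_sqrt ha.le]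
      convert posSemidef_smul_one_sub_inv ha hVs using 2
      calc _ = G⁻¹ * (Vᵀ * (S * S) * V) * G⁻¹ := by
            rw [transpose_mul, transpose_mul, hSt, hGs]
            simp only [Matrix.mul_assoc]
        _ = _ := by rw [hSS, ← hG, nonsing_inv_mul _ hd, one_mul]
    have hsa : 0 < √a := Real.sqrt_pos.2 ha
    have n5 : ‖(S * U)ᵀ * (S * V * G⁻¹) * Vᵀ‖ ≤ c := by
      calc _ ≤ ‖(S * U)ᵀ‖ * ‖S * V * G⁻¹‖ * ‖Vᵀ‖ :=
            (l2_opNorm_mul _ _).trans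
              (mul_le_mul_of_nonneg_right (l2_opNorm_mul _ _) (norm_nonneg _))
        _ ≤ c * √a * (√a)⁻¹ * 1 := by gcongr
        _ = c := by field_simp
    rw [hX, mul_comm (1 + c)]
    refine (l2_opNorm_mul _ _).trans (mul_le_mul_of_nonneg_left ?_ (norm_nonneg _))
    exact (norm_sub_le _ _).trans (add_le_add n1 n5)

end

lemma exists_ne_zero_mulVec_eq_zero {m k : Type*} [Fintype m] [Fintype k]
    {X : Matrix m k ℝ} (h : X.rank < Fintype.card k) : ∃ y ≠ 0, X *ᵥ y = 0 := by
  by_contra! hne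
  have hker : LinearMap.ker X.mulVecLin = ⊥ :=
    (Submodule.eq_bot_iff _).2 fun y hy => by
      by_contra h0
      exact hne y h0 (by simpa using hy)
  have hdim := X.mulVecLin.finrank_range_add_finrank_ker
  rw [hker, finrank_bot, Module.finrank_fintype_fun_eq_card] at hdim
  rw [Matrix.rank] at h
  omega

lemma exists_antitone_diagonalization {m n : ℕ} (A : Matrix (Fin m) (Fin n) ℝ) :
    ∃ (W : Matrix (Fin n) (Fin n) ℝ) (μ : Fin n → ℝ), Wᵀ * W = 1 ∧ Antitone μ ∧ (∀ i, 0 ≤ μ i) ∧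
      Wᵀ * (Aᵀ * A) * W = diagonal μ ∧ ∀ j : Fin n, A.rank ≤ j → μ j = 0 := by
  have hpsd : (Aᵀ * A).PosSemidef := by simpa using posSemidef_conjTranspose_mul_self A
  set ν := hpsd.1.eigenvalues
  set P := (hpsd.1.eigenvectorUnitary : Matrix (Fin n) (Fin n) ℝ)
  have hPP : Pᵀ * P = 1 := by
    rw [← conjTranspose_eq_transpose_of_trivial]
    exact Unitary.coe_star_mul_self hpsd.1.eigenvectorUnitary
  have hdiag : Pᵀ * (Aᵀ * A) * P = diagonal ν := by
    have h := hpsd.1.spectral_theorem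
    rw [Unitary.conjStarAlgAut_apply] at h
    have h' : Aᵀ * A = P * diagonal ν * Pᵀ := h
    calc _ = (Pᵀ * P) * diagonal ν * (Pᵀ * P) := by rw [h']; simp only [Matrix.mul_assoc]
      _ = _ := by rw [hPP, one_mul, mul_one]
  let σ : Equiv.Perm (Fin n) := Tuple.sort fun i => -ν i
  have hanti : Antitone (ν ∘ σ) := fun i j hij => neg_le_neg_iff.1
    (Tuple.monotone_sort (fun i => -ν i) hij)
  refine ⟨P.submatrix id σ, ν ∘ σ, ?_, hanti, fun i => hpsd.eigenvalues_nonneg _, ?_, ?_⟩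
  · rw [← submatrix_one_equiv σ, ← hPP]
    rfl
  · rw [← submatrix_diagonal_equiv, ← hdiag]
    rfl
  · intro j hj
    by_contra hne
    have hrank := hpsd.1.rank_eq_card_non_zero_eigs
    have hjpos : 0 < (ν ∘ σ) j := (hpsd.eigenvalues_nonneg _).lt_of_ne' hne
    have hsub : (Finset.Iic j).map σ.toEmbedding ⊆ Finset.univ.filter fun i => ν i ≠ 0 := by
      intro i hi
      obtain ⟨i', hi', rfl⟩ := Finset.mem_map.1 hi
      simpa using (hjpos.trans_le (hanti (Finset.mem_Iic.1 hi'))).ne'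
    have hcard := Finset.card_le_card hsub
    rw [Finset.card_map, Fin.card_Iic, ← Fintype.card_subtype, ← hrank] at hcard
    have : (Aᵀ * A).rank = A.rank := rank_transpose_mul_self A
    omega

lemma le_specErr_of_diagonalization {m n k : ℕ} {A : Matrix (Fin m) (Fin n) ℝ}
    {W : Matrix (Fin n) (Fin n) ℝ} {μ : Fin n → ℝ} (hW : Wᵀ * W = 1) (hμ : Antitone μ)
    (hA : Wᵀ * (Aᵀ * A) * W = diagonal μ) (hk : k < n) :
    √(μ ⟨k, hk⟩) ≤ specErr A k := by
  refine le_csInf ⟨_, 0, by simp, rfl⟩ ?_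
  rintro _ ⟨X, hX, rfl⟩
  rw [spec_eq_l2_opNorm]
  set g : Fin (k + 1) → Fin n := Fin.castLE hk
  set W' := W.submatrix id g
  have hg_inj : Function.Injective g := Fin.castLE_injective _
  have hWW : W'ᵀ * W' = 1 := by
    have : W'ᵀ * W' = (Wᵀ * W).submatrix g g := rfl
    rw [this, hW, submatrix_one _ hg_inj]
  have hAW : (A * W')ᵀ * (A * W') = diagonal (μ ∘ g) := by
    have h1 : (A * W')ᵀ * (A * W') = W'ᵀ * (Aᵀ * A) * W' := by
      rw [transpose_mul]; simp only [Matrix.mul_assoc]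
    have h2 : W'ᵀ * (Aᵀ * A) * W' = (Wᵀ * (Aᵀ * A) * W).submatrix g g := rfl
    rw [h1, h2, hA]
    ext i j
    by_cases h : i = j <;> simp [h, hg_inj.eq_iff]
  obtain ⟨y, hy0, hy⟩ := exists_ne_zero_mulVec_eq_zero (X := X * W') (by
    simpa using Nat.lt_succ_of_le ((rank_mul_le_left X W').trans hX))
  refine Real.sqrt_le_iff.2 ⟨norm_nonneg _, ?_⟩
  have hyy : 0 < y ⬝ᵥ y := by
    have := (dotProduct_star_self_pos_iff (v := y)).2 hy0
    simpa using this
  have h1 := mulVec_dotProduct_mulVec_self_le (A - X) (W' *ᵥ y)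
  rw [mulVec_dotProduct_mulVec_self W', hWW, one_mulVec, mulVec_mulVec, Matrix.sub_mul, sub_mulVec,
    hy, sub_zero, mulVec_dotProduct_mulVec_self, hAW] at h1
  refine le_of_mul_le_mul_right (le_trans ?_ h1) hyy
  simp only [dotProduct, mulVec_diagonal, Finset.mul_sum]
  refine Finset.sum_le_sum fun i _ => ?_
  have : μ ⟨k, hk⟩ ≤ μ (g i) := hμ (by
    rw [Fin.le_def]; exact Nat.lt_succ_iff.1 i.2)
  simp only [Function.comp_apply]
  nlinarith [mul_nonneg (sub_nonneg.2 this) (mul_self_nonneg (y i))]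

lemma sum_fin_eq_of_forall_eq_zero {k l n : ℕ} (h : k + l ≤ n) {f : Fin n → ℝ}
    (hf : ∀ j : Fin n, k + l ≤ j → f j = 0) :
    ∑ j, f j = ∑ i : Fin k, f ⟨i, by omega⟩ + ∑ i : Fin l, f ⟨k + i, by omega⟩ := by
  obtain ⟨q, rfl⟩ := Nat.exists_eq_add_of_le h
  rw [Fin.sum_univ_add, Fin.sum_univ_add]
  rw [Finset.sum_eq_zero (s := (Finset.univ : Finset (Fin q))) fun i _ => hf _ (by simp), add_zero]
  rfl

lemma exists_top_split {m n k l : ℕ} (A : Matrix (Fin m) (Fin n) ℝ) (hl : 0 < l)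
    (hkl : k + l = A.rank) :
    ∃ (V : Matrix (Fin n) (Fin k) ℝ) (U : Matrix (Fin n) (Fin l) ℝ), Vᵀ * V = 1 ∧ Uᵀ * U = 1 ∧
      A = A * V * Vᵀ + A * U * Uᵀ ∧ ‖A * U‖ ≤ specErr A k := by
  obtain ⟨W, μ, hW, hμ, hμ0, hA, hz⟩ := exists_antitone_diagonalization A
  have hn : k + l ≤ n := hkl ▸ A.rank_le_width
  set gV : Fin k → Fin n := fun i => ⟨i, by omega⟩ with hgV
  set gU : Fin l → Fin n := fun i => ⟨k + i, by omega⟩ with hgU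
  have hgVi : Function.Injective gV := fun i j h => by simpa [hgV, Fin.ext_iff] using h
  have hgUi : Function.Injective gU := fun i j h => by simpa [hgU, Fin.ext_iff] using h
  have hkn : k < n := by omega
  have hAW : (A * W)ᵀ * (A * W) = diagonal μ := by
    rw [← hA, transpose_mul]; simp only [Matrix.mul_assoc]
  refine ⟨W.submatrix id gV, W.submatrix id gU, ?_, ?_, ?_, ?_⟩
  · rw [← submatrix_one gV hgVi, ← hW]; rfl
  · rw [← submatrix_one gU hgUi, ← hW]; rfl
  · have hcol : ∀ (a : Fin m) (j : Fin n), A.rank ≤ j → (A * W) a j = 0 := by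
      intro a j hj
      have h1 : ∑ a, (A * W) a j * (A * W) a j = 0 := by
        have := congrFun (congrFun hAW j) j
        rw [diagonal_apply_eq, hz j hj] at this
        exact this
      exact mul_self_eq_zero.1
        ((Finset.sum_eq_zero_iff_of_nonneg fun _ _ => mul_self_nonneg _).1 h1 a (Finset.mem_univ a))
    have hWW : W * Wᵀ = 1 := mul_eq_one_comm.1 hW
    ext a b
    calc A a b = (A * W * Wᵀ) a b := by rw [Matrix.mul_assoc, hWW, Matrix.mul_one]
      _ = ∑ j, (A * W) a j * W b j := rfl
      _ = _ := sum_fin_eq_of_forall_eq_zero hn fun j hj => by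
        rw [hcol a j (hkl ▸ hj), zero_mul]
  · refine le_trans ?_ (le_specErr_of_diagonalization hW hμ hA hkn)
    refine l2_opNorm_le_of_posSemidef (Real.sqrt_nonneg _) ?_
    rw [Real.sq_sqrt (hμ0 _)]
    have h1 : (A * W.submatrix id gU)ᵀ * (A * W.submatrix id gU) = diagonal (μ ∘ gU) := by
      have : (A * W.submatrix id gU)ᵀ * (A * W.submatrix id gU) =
        ((A * W)ᵀ * (A * W)).submatrix gU gU := rfl
      rw [this, hAW]
      ext i j
      by_cases h : i = j <;> simp [h, hgUi.eq_iff]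
    have h2 : μ ⟨k, hkn⟩ • 1 - diagonal (μ ∘ gU) =
        diagonal fun i => μ ⟨k, hkn⟩ - μ (gU i) := by
      ext i j
      by_cases h : i = j <;> simp [h]
    rw [h1, h2]
    exact PosSemidef.diagonal fun i => sub_nonneg.2 (hμ (by simp [hgU, Fin.le_def]))

lemma exists_injective_fin_range_superset {n r : ℕ} {T : Finset (Fin n)} (hT : T.card ≤ r)
    (hr : r ≤ n) : ∃ f : Fin r → Fin n, Function.Injective f ∧ ↑T ⊆ Set.range f := by
  obtain ⟨T', hTT', hT'⟩ := Finset.exists_superset_card_eq hT (by simpa using hr)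
  exact ⟨T'.orderEmbOfFin hT', (T'.orderEmbOfFin hT').injective, by
    rw [Finset.range_orderEmbOfFin]; exact_mod_cast hTT'⟩

end Spectral
end Matrix

/-- **Deterministic spectral norm reconstruction** (Theorem 1 of
Boutsidis–Drineas–Magdon-Ismail): for any real `m × n` matrix `A` of rank `ρ`, any target
rank `k` with `1 ≤ k < ρ`, and any `r` with `k < r ≤ n`, there exist `r` columns of `A`
forming a matrix `C` such that
`‖A - Π²_{C,k}(A)‖₂ ≤ (1 + (1 + √((ρ-k)/r)) / (1 - √(k/r))) ‖A - A_k‖₂`. -/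
theorem spectral_norm_column_reconstruction
    {m n : ℕ} (A : Matrix (Fin m) (Fin n) ℝ) (k : ℕ)
    (hk1 : 1 ≤ k) (hk : k < A.rank) (r : ℕ) (hkr : k < r) (hrn : r ≤ n) :
    ∃ f : Fin r → Fin n, Function.Injective f ∧
      specErrIn A (A.submatrix id f) k ≤
        (1 + (1 + Real.sqrt (((A.rank : ℝ) - (k : ℝ)) / (r : ℝ))) /
              (1 - Real.sqrt ((k : ℝ) / (r : ℝ)))) * specErr A k := by
  obtain ⟨l, hl⟩ := Nat.exists_eq_add_of_lt hk
  have hkl : k + (l + 1) = A.rank := by omega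
  have hrank : (A.rank : ℝ) - k = (l + 1 : ℕ) := by
    rw [← hkl]; push_cast; ring
  rw [hrank]
  have hlpos : (0 : ℝ) < (l + 1 : ℕ) := by positivity
  set L := ((l + 1 : ℕ) : ℝ) with hL
  have hkpos : (0 : ℝ) < k := by exact_mod_cast hk1
  have hkr' : (k : ℝ) < r := by exact_mod_cast hkr
  have hrpos : (0 : ℝ) < r := hkpos.trans hkr'
  obtain ⟨V, U, hV, hU, hVU, hAU⟩ := exists_top_split A (Nat.succ_pos l) hkl
  have : Nonempty (Fin k) := ⟨⟨0, hk1⟩⟩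
  rw [Real.sqrt_div hlpos.le, Real.sqrt_div hkpos.le]
  have hx : 0 < √(k : ℝ) := Real.sqrt_pos.2 hkpos
  have hy : 0 < √L := Real.sqrt_pos.2 hlpos
  have hxz : √(k : ℝ) < √(r : ℝ) := Real.sqrt_lt_sqrt hkpos.le hkr'
  have hxx : √(k : ℝ) ^ 2 = k := Real.sq_sqrt hkpos.le
  have hyy : √L ^ 2 = L := Real.sq_sqrt hlpos.le
  have hzz : √(r : ℝ) ^ 2 = r := Real.sq_sqrt hrpos.le
  set x := √(k : ℝ)
  set y := √L
  set z := √(r : ℝ)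
  have hz : 0 < z := hx.trans hxz
  have hzx : 0 < z - x := sub_pos.2 hxz
  have hδ : (1 + y / z) / (1 - x / z) = (z + y) / (z - x) := by
    have : 1 - x / z = (z - x) / z := by field_simp
    rw [this]
    field_simp
  rw [hδ]
  set δ := (z + y) / (z - x) with hδdef
  have hδpos : 0 < δ := by positivity
  obtain ⟨s, T, hs, hT, hsT, hlow, -, hup, -⟩ := exists_sparse_weights hV hU (δ := δ)
    (ε := x / z) (φ := y / z / δ) (p := z * x) (q := δ * (y * z)) hδpos ((div_lt_one hz).2 hxz)
    (by
      rw [hδdef]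
      apply le_of_eq
      field_simp)
    (by positivity)
    (by
      rw [Fintype.card_fin, ← hxx]
      apply le_of_eq
      field_simp)
    (by positivity)
    (by
      rw [Fintype.card_fin, ← hL, ← hyy]
      apply le_of_eq
      field_simp) r
  obtain ⟨f, hf, hTf⟩ := exists_injective_fin_range_superset hT hrn
  have ha : 0 < (r : ℝ) - z * x := by rw [← hzz]; nlinarith
  have hb : δ * (y * z) + δ * r = δ ^ 2 * (r - z * x) := by
    rw [← hzz, hδdef]
    field_simp
    ring
  rw [hb] at hup
  obtain ⟨X, hXk, hXC, hX⟩ := exists_approx_of_weights A hV hU hVU hs hf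
    (fun i hi => hsT i fun hiT => hi (hTf hiT)) ha hδpos.le hlow hup.posSemidef
  refine ⟨f, hf, le_trans (csInf_le ⟨0, ?_⟩ ⟨X, by simpa using hXk, hXC, rfl⟩)
    (hX.trans (mul_le_mul_of_nonneg_left hAU (by positivity)))⟩
  rintro _ ⟨Y, -, -, rfl⟩
  exact norm_nonneg _
end

section
/- Let A be a real m×n matrix of rank ρ and let k be an integer with 1 ≤ k < ρ. For every integer r with k < r ≤ n there exists a matrix C ∈ R^{m×r} whose columns are r columns of A such that ‖A − Π^F_{C,k}(A)‖_F² ≤ (1 + 1/(1 − √(k/r))²) · ‖A − A_k‖_F². -/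
open Matrix MeasureTheory

theorem transpose_mul_diagonal_single_mul {ι κ : Type*} [Fintype ι] [DecidableEq ι]
    (V : Matrix ι κ ℝ) (i : ι) (t : ℝ) :
    Vᵀ * diagonal (Pi.single i t) * V = t • vecMulVec (V i) (V i) := by
  ext p q
  rw [Matrix.mul_apply]
  simp only [Matrix.mul_diagonal, Matrix.transpose_apply, Pi.single_apply, mul_ite, ite_mul,
    mul_zero, zero_mul, Finset.sum_ite_eq', Finset.mem_univ, if_true, Matrix.smul_apply,
    vecMulVec_apply, smul_eq_mul]
  ring

section BarrierMethod

variable {ι κ μ : Type*} [Fintype ι] [Fintype κ] [Fintype μ]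

theorem frobSq_eq_trace (M : Matrix μ ι ℝ) : frobSq M = (M * Mᵀ).trace := by
  simp [frobSq, Matrix.trace, Matrix.mul_apply, sq]

theorem frobSq_nonneg (M : Matrix μ ι ℝ) : 0 ≤ frobSq M :=
  Finset.sum_nonneg fun _ _ => Finset.sum_nonneg fun _ _ => sq_nonneg _

/-- Pythagoras for matrices with orthogonal rows. -/
theorem frobSq_sub_of_mul_transpose_eq_zero {M N : Matrix μ ι ℝ} (h : M * Nᵀ = 0) :
    frobSq (M - N) = frobSq M + frobSq N := by
  have h' : N * Mᵀ = 0 := by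
    simpa using congrArg Matrix.transpose h
  simp only [frobSq_eq_trace, Matrix.transpose_sub, Matrix.mul_sub, Matrix.sub_mul, h, h',
    Matrix.trace_sub, Matrix.trace_zero]
  ring

open scoped MatrixOrder Matrix.Norms.L2Operator in
theorem dotProduct_mulVec_le_trace {Q : Matrix κ κ ℝ} (hQ : Q.PosSemidef) (x : κ → ℝ) :
    x ⬝ᵥ (Q *ᵥ x) ≤ Q.trace * (x ⬝ᵥ x) := by
  classical
  obtain ⟨C, hC⟩ := CStarAlgebra.nonneg_iff_eq_star_mul_self.mp hQ.nonneg
  obtain rfl : Q = Cᴴ * C := hC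
  have h1 : x ⬝ᵥ ((Cᴴ * C) *ᵥ x) = ∑ i, (∑ j, C i j * x j) ^ 2 := by
    rw [← Matrix.mulVec_mulVec, Matrix.dotProduct_mulVec, Matrix.conjTranspose_eq_transpose_of_trivial,
      Matrix.vecMul_transpose]
    simp [dotProduct, Matrix.mulVec, sq]
  have h2 : (Cᴴ * C).trace = ∑ i, ∑ j, C i j ^ 2 := by
    rw [Matrix.trace_mul_comm]
    simp [Matrix.trace, Matrix.mul_apply, sq]
  rw [h1, h2, Finset.sum_mul]
  refine Finset.sum_le_sum fun i _ => ?_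
  have := Finset.sum_mul_sq_le_sq_mul_sq Finset.univ (C i) x
  simpa [dotProduct, sq] using this

theorem sum_dotProduct_mulVec_eq_trace [DecidableEq κ] {V : Matrix ι κ ℝ} (hV : Vᵀ * V = 1)
    (M : Matrix κ κ ℝ) : ∑ i, V i ⬝ᵥ (M *ᵥ V i) = M.trace := by
  have h : M.trace = (V * M * Vᵀ).trace := by
    rw [Matrix.trace_mul_comm, ← Matrix.mul_assoc, hV, Matrix.one_mul]
  rw [h]
  refine Finset.sum_congr rfl fun i _ => ?_
  rw [Matrix.diag_apply, Matrix.mul_assoc, Matrix.mul_apply]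
  rfl

variable [DecidableEq κ]

theorem posDef_sub_one_of_trace_inv_lt_one {B : Matrix κ κ ℝ} (hB : B.PosDef)
    (htr : B⁻¹.trace < 1) : (B - 1).PosDef := by
  refine .of_dotProduct_mulVec_pos (hB.1.sub Matrix.isHermitian_one) fun x hx => ?_
  have hdet : IsUnit B.det := (Matrix.isUnit_iff_isUnit_det B).1 hB.isUnit
  have hBB : B * B⁻¹ = 1 := Matrix.mul_nonsing_inv B hdet
  have hsymm : Bᵀ = B := hB.1
  have hxx : 0 < x ⬝ᵥ x := by simpa using Matrix.dotProduct_star_self_pos_iff.2 hx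
  have h1 := dotProduct_mulVec_le_trace hB.inv.posSemidef x
  have h2 := hB.posSemidef.dotProduct_mulVec_nonneg (x - B⁻¹ *ᵥ x)
  have h3 : (B⁻¹ *ᵥ x) ⬝ᵥ (B *ᵥ x) = x ⬝ᵥ x := by
    rw [Matrix.dotProduct_mulVec, ← Matrix.mulVec_transpose, hsymm, Matrix.mulVec_mulVec, hBB,
      Matrix.one_mulVec]
  simp only [star_trivial, Matrix.mulVec_sub, Matrix.mulVec_mulVec, hBB, Matrix.one_mulVec,
    sub_dotProduct, dotProduct_sub, h3] at h2
  rw [dotProduct_comm (B⁻¹ *ᵥ x) x] at h2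
  simp only [star_trivial, Matrix.sub_mulVec, Matrix.one_mulVec, dotProduct_sub]
  nlinarith

/-- The barrier inequality: moving the lower barrier by one unit costs `Δ` in the potential,
and `Δ + Δ²` is controlled by the trace of the squared inverse. -/
theorem trace_inv_shift_bounds [Nonempty κ] {B : Matrix κ κ ℝ} (hB : B.PosDef)
    (hD : (B - 1).PosDef) (htr : B⁻¹.trace ≤ 1) :
    0 < (B - 1)⁻¹.trace - B⁻¹.trace ∧
      ((B - 1)⁻¹.trace - B⁻¹.trace) + ((B - 1)⁻¹.trace - B⁻¹.trace) ^ 2 ≤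
        ((B - 1)⁻¹ * (B - 1)⁻¹).trace := by
  have hBd : IsUnit B.det := (Matrix.isUnit_iff_isUnit_det B).1 hB.isUnit
  have hDd : IsUnit (B - 1).det := (Matrix.isUnit_iff_isUnit_det _).1 hD.isUnit
  set P := (B - 1)⁻¹ with hP
  set Q := B⁻¹ with hQ
  have hBQ : B * Q = 1 := Matrix.mul_nonsing_inv B hBd
  have hQB : Q * B = 1 := Matrix.nonsing_inv_mul B hBd
  have hDP : (B - 1) * P = 1 := Matrix.mul_nonsing_inv _ hDd
  have hPD : P * (B - 1) = 1 := Matrix.nonsing_inv_mul _ hDd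
  have hQP : P - Q = Q * P := by
    calc P - Q = (Q * B) * P - Q * ((B - 1) * P) := by rw [hQB, hDP]; simp
      _ = Q * P := by noncomm_ring
  have hPQ : P - Q = P * Q := by
    calc P - Q = P * (B * Q) - (P * (B - 1)) * Q := by rw [hBQ, hPD]; simp
      _ = P * Q := by noncomm_ring
  have hPsymm : Pᴴ = P := hD.inv.1
  have hQsymm : Qᴴ = Q := hB.inv.1
  have hQPQ : P * Q = Qᴴ * Q + Qᴴ * P * Q := by
    rw [hQsymm, ← add_mul, ← hQP]; congr 1; abel
  have hQQ : (Qᴴ * Q).PosDef := by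
    have := Matrix.PosDef.one (n := κ) (R := ℝ)
    have h := this.conjTranspose_mul_mul_same
      (Matrix.mulVec_injective_iff_isUnit.2 hB.inv.isUnit)
    simpa using h
  have hpos : 0 < P.trace - Q.trace := by
    rw [← Matrix.trace_sub, hPQ, hQPQ]
    exact (hQQ.add_posSemidef (hD.inv.posSemidef.conjTranspose_mul_mul_same Q)).trace_pos
  refine ⟨hpos, ?_⟩
  set Δ := P.trace - Q.trace with hΔ
  have hΔPQ : (P * Q).trace = Δ := by rw [← hPQ, Matrix.trace_sub]
  have hΔQP : (Q * P).trace = Δ := by rw [← hQP, Matrix.trace_sub]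
  have hPP : (P * P).trace = Δ + (P * Q * P).trace := by
    rw [← hΔPQ, ← Matrix.trace_add, Matrix.mul_assoc, ← hQP]
    congr 1; noncomm_ring
  have hsq : 0 ≤ ((P - Δ • (1 : Matrix κ κ ℝ))ᴴ * Q * (P - Δ • (1 : Matrix κ κ ℝ))).trace :=
    (hB.inv.posSemidef.conjTranspose_mul_mul_same _).trace_nonneg
  rw [Matrix.conjTranspose_sub, hPsymm, Matrix.conjTranspose_smul, Matrix.conjTranspose_one,
    star_trivial] at hsq
  simp only [Matrix.sub_mul, Matrix.mul_sub, Matrix.smul_mul, Matrix.mul_smul, Matrix.one_mul,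
    Matrix.mul_one, Matrix.trace_sub, Matrix.trace_smul, smul_eq_mul, hΔPQ, hΔQP] at hsq
  rw [hPP]
  nlinarith [mul_le_mul_of_nonneg_left htr (sq_nonneg Δ)]

/-- A rank-one update with suitable weight decreases the trace of the inverse by
exactly `Δ` (Sherman–Morrison). -/
theorem trace_inv_add_smul_vecMulVec {D : Matrix κ κ ℝ} (hD : D.PosDef) (v : κ → ℝ) {Δ L : ℝ}
    (hΔ : 0 < Δ) (hL : 0 < L)
    (hLeq : L = v ⬝ᵥ ((D⁻¹ * D⁻¹) *ᵥ v) / Δ - v ⬝ᵥ (D⁻¹ *ᵥ v)) :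
    (D + L⁻¹ • vecMulVec v v)⁻¹.trace = D⁻¹.trace - Δ := by
  have hDd : IsUnit D.det := (Matrix.isUnit_iff_isUnit_det _).1 hD.isUnit
  have hDP : D * D⁻¹ = 1 := Matrix.mul_nonsing_inv D hDd
  have hPsymm : (D⁻¹)ᵀ = D⁻¹ := hD.inv.1
  set P := D⁻¹ with hP
  set w := P *ᵥ v with hw
  set p := v ⬝ᵥ w with hp
  set q := v ⬝ᵥ ((P * P) *ᵥ v) with hq
  have hp0 : 0 ≤ p := by
    simpa using hD.inv.posSemidef.dotProduct_mulVec_nonneg v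
  have hLp : L + p = q / Δ := by rw [hLeq]; ring
  have hq0 : 0 < q := by
    have : 0 < q / Δ := by rw [← hLp]; positivity
    simpa using (div_pos_iff_of_pos_right hΔ).1 this
  have hww : w ⬝ᵥ w = q := by
    rw [hq, ← Matrix.mulVec_mulVec, Matrix.dotProduct_mulVec v, ← Matrix.mulVec_transpose, hPsymm]
  have hDw : D *ᵥ w = v := by rw [hw, Matrix.mulVec_mulVec, hDP, Matrix.one_mulVec]
  have hvP : v ᵥ* P = w := by rw [← Matrix.mulVec_transpose, hPsymm]
  have hinv : (D + L⁻¹ • vecMulVec v v)⁻¹ = P - (Δ / q) • vecMulVec w w := by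
    apply Matrix.inv_eq_right_inv
    have h1 : D * vecMulVec w w = vecMulVec v w := by rw [Matrix.mul_vecMulVec, hDw]
    have h2 : vecMulVec v v * P = vecMulVec v w := by rw [Matrix.vecMulVec_mul, hvP]
    have h3 : vecMulVec v v * vecMulVec w w = p • vecMulVec v w := by
      rw [Matrix.vecMulVec_mul_vecMulVec, hp]
      ext i j; simp [vecMulVec_apply]; ring
    rw [Matrix.mul_sub, Matrix.add_mul, Matrix.mul_smul, Matrix.add_mul, Matrix.smul_mul,
      Matrix.smul_mul, hDP, h1, h2, h3]
    have hc : L⁻¹ - (Δ / q) * (1 + L⁻¹ * p) = 0 := by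
      have : 1 + L⁻¹ * p = L⁻¹ * (q / Δ) := by rw [← hLp]; field_simp
      rw [this]; field_simp; ring
    calc _ = 1 + (L⁻¹ - (Δ / q) * (1 + L⁻¹ * p)) • vecMulVec v w := by module
      _ = 1 := by rw [hc]; simp
  rw [hinv, Matrix.trace_sub, Matrix.trace_smul, Matrix.trace_vecMulVec, hww, smul_eq_mul,
    div_mul_cancel₀ _ hq0.ne']

/-- One step of the lower-barrier argument of Batson, Spielman and Srivastava, with a linear
budget in place of the upper barrier. -/
theorem exists_barrier_step [Nonempty κ] {V : Matrix ι κ ℝ} (hV : Vᵀ * V = 1) {a : ι → ℝ}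
    (ha : ∀ i, 0 ≤ a i) {φ : ℝ} (hφ : φ < 1) {B : Matrix κ κ ℝ} (hB : B.PosDef)
    (htr : B⁻¹.trace ≤ φ) :
    ∃ (i : ι) (t : ℝ), 0 ≤ t ∧ (B - 1 + t • vecMulVec (V i) (V i)).PosDef ∧
      (B - 1 + t • vecMulVec (V i) (V i))⁻¹.trace ≤ φ ∧ t * a i * (1 - φ) ≤ ∑ j, a j := by
  have hD := posDef_sub_one_of_trace_inv_lt_one hB (htr.trans_lt hφ)
  obtain ⟨hΔ, hbound⟩ := trace_inv_shift_bounds hB hD (htr.trans hφ.le)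
  set Δ := (B - 1)⁻¹.trace - B⁻¹.trace with hΔdef
  set L : ι → ℝ := fun i => V i ⬝ᵥ (((B - 1)⁻¹ * (B - 1)⁻¹) *ᵥ V i) / Δ -
    V i ⬝ᵥ ((B - 1)⁻¹ *ᵥ V i) with hLdef
  have hLsum : 1 - φ ≤ ∑ i, L i := by
    rw [hLdef, Finset.sum_sub_distrib, ← Finset.sum_div, sum_dotProduct_mulVec_eq_trace hV,
      sum_dotProduct_mulVec_eq_trace hV]
    have : 1 + Δ ≤ ((B - 1)⁻¹ * (B - 1)⁻¹).trace / Δ := by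
      rw [le_div_iff₀ hΔ]; nlinarith
    linarith
  have hS : 0 ≤ ∑ j, a j := Finset.sum_nonneg fun j _ => ha j
  obtain ⟨i, hLi, hi⟩ : ∃ i, 0 < L i ∧ a i * (1 - φ) ≤ L i * ∑ j, a j := by
    by_contra! hcon
    have hle : ∀ i ∈ Finset.univ, L i * ∑ j, a j ≤ a i * (1 - φ) := fun i _ => by
      rcases lt_or_ge 0 (L i) with h | h
      · exact (hcon i h).le
      · exact (mul_nonpos_of_nonpos_of_nonneg h hS).trans
          (mul_nonneg (ha i) (sub_nonneg.2 hφ.le))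
    have hsum : ∑ i, a i * (1 - φ) ≤ ∑ i, L i * ∑ j, a j := by
      rw [← Finset.sum_mul, ← Finset.sum_mul, mul_comm]
      exact mul_le_mul_of_nonneg_right hLsum hS
    have heq := (Finset.sum_eq_sum_iff_of_le hle).1 (le_antisymm (Finset.sum_le_sum hle) hsum)
    have : ∑ i, L i ≤ 0 := Finset.sum_nonpos fun i hi => by
      by_contra! h
      exact (hcon i h).ne (heq i hi)
    linarith
  refine ⟨i, (L i)⁻¹, inv_nonneg.2 hLi.le, ?_, ?_, ?_⟩
  · refine hD.add_posSemidef (Matrix.PosSemidef.smul ?_ (inv_nonneg.2 hLi.le))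
    simpa using Matrix.posSemidef_vecMulVec_self_star (V i)
  · rw [trace_inv_add_smul_vecMulVec hD (V i) hΔ hLi rfl]
    linarith
  · rw [mul_assoc, inv_mul_le_iff₀ hLi]
    exact hi

variable [DecidableEq ι]

theorem exists_barrier_weights [Nonempty κ] {V : Matrix ι κ ℝ} (hV : Vᵀ * V = 1) {a : ι → ℝ}
    (ha : ∀ i, 0 ≤ a i) {φ c : ℝ} (hφ : φ < 1) (hc : 0 < c) (hcφ : Fintype.card κ / c ≤ φ)
    (N : ℕ) :
    ∃ s : ι → ℝ, (∀ i, 0 ≤ s i) ∧ (Finset.univ.filter fun i => s i ≠ 0).card ≤ N ∧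
      ((c - N) • (1 : Matrix κ κ ℝ) + Vᵀ * diagonal s * V).PosDef ∧
      ((c - N) • (1 : Matrix κ κ ℝ) + Vᵀ * diagonal s * V)⁻¹.trace ≤ φ ∧
      (∑ i, s i * a i) * (1 - φ) ≤ N * ∑ i, a i := by
  induction N with
  | zero =>
    refine ⟨0, by simp, by simp, ?_, ?_, by simp⟩
    · simpa using Matrix.PosDef.one.smul hc
    · have : (c • (1 : Matrix κ κ ℝ))⁻¹ = c⁻¹ • 1 :=
        Matrix.inv_eq_right_inv (by simp [hc.ne'])
      simpa [this, div_eq_inv_mul] using hcφ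
  | succ N ih =>
    obtain ⟨s, hs, hcard, hpd, htr, hsum⟩ := ih
    obtain ⟨i, t, ht, hpd', htr', hta⟩ := exists_barrier_step hV ha hφ hpd htr
    have heq : (c - (N + 1 : ℕ)) • (1 : Matrix κ κ ℝ) +
        Vᵀ * diagonal (s + Pi.single i t) * V =
        (c - N) • (1 : Matrix κ κ ℝ) + Vᵀ * diagonal s * V - 1 +
          t • vecMulVec (V i) (V i) := by
      have : diagonal (s + Pi.single i t) = diagonal s + diagonal (Pi.single i t) :=
        (diagonal_add _ _).symm
      rw [this, Matrix.mul_add, Matrix.add_mul, transpose_mul_diagonal_single_mul]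
      push_cast
      module
    refine ⟨s + Pi.single i t, fun j => ?_, ?_, by rwa [heq], by rwa [heq], ?_⟩
    · exact add_nonneg (hs j) ((Pi.single_nonneg.2 ht : (0 : ι → ℝ) ≤ Pi.single i t) j)
    · refine (Finset.card_le_card (t := insert i (Finset.univ.filter fun j => s j ≠ 0)) ?_).trans
        ((Finset.card_insert_le _ _).trans (by lia))
      intro j hj
      by_cases hji : j = i
      · simp [hji]
      · simpa [hji] using hj
    · simp only [Pi.add_apply, add_mul, Finset.sum_add_distrib, Pi.single_apply, ite_mul, zero_mul,
        Finset.sum_ite_eq', Finset.mem_univ, if_true]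
      push_cast
      linarith

/-- The weighted least-squares regression of the residual on the selected columns is small. -/
theorem frobSq_mul_diagonal_mul_inv_le {V : Matrix ι κ ℝ} {s : ι → ℝ} (hs : ∀ i, 0 ≤ s i)
    {l : ℝ} (hl : 0 < l) (hG : (Vᵀ * diagonal s * V - l • (1 : Matrix κ κ ℝ)).PosSemidef)
    (E : Matrix μ ι ℝ) :
    l * frobSq (E * diagonal s * V * (Vᵀ * diagonal s * V)⁻¹) ≤
      (E * diagonal s * Eᵀ).trace := by
  set G := Vᵀ * diagonal s * V with hGdef
  have hGpd : G.PosDef := by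
    have := (Matrix.PosDef.one (n := κ) (R := ℝ) |>.smul hl).add_posSemidef hG
    simpa using this
  have hdet : IsUnit G.det := (Matrix.isUnit_iff_isUnit_det _).1 hGpd.isUnit
  have hGG : G⁻¹ * G = 1 := Matrix.nonsing_inv_mul G hdet
  set W := E * diagonal s * V * G⁻¹ with hW
  have hWG : W * G = E * diagonal s * V := by rw [hW, Matrix.mul_assoc, hGG, Matrix.mul_one]
  have h1 : 0 ≤ (W * (G - l • (1 : Matrix κ κ ℝ)) * Wᵀ).trace := by
    simpa using (hG.mul_mul_conjTranspose_same W).trace_nonneg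
  have h2 : 0 ≤ ((E - W * Vᵀ) * diagonal s * (E - W * Vᵀ)ᵀ).trace := by
    simpa using ((Matrix.PosSemidef.diagonal (show 0 ≤ s from hs)).mul_mul_conjTranspose_same
      (E - W * Vᵀ)).trace_nonneg
  have h3 : (W * Vᵀ * diagonal s * Eᵀ) = W * G * Wᵀ := by
    have hT : (W * G)ᵀ = Vᵀ * diagonal s * Eᵀ := by
      rw [hWG]; simp [Matrix.mul_assoc]
    have hGs : Gᵀ = G := hGpd.1
    rw [Matrix.transpose_mul, hGs] at hT
    simp only [Matrix.mul_assoc] at hT ⊢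
    rw [hT]
  have h4 : E * diagonal s * (W * Vᵀ)ᵀ = W * G * Wᵀ := by
    rw [hWG]; simp [Matrix.mul_assoc]
  have h5 : W * Vᵀ * diagonal s * (W * Vᵀ)ᵀ = W * G * Wᵀ := by
    rw [hGdef]; simp [Matrix.mul_assoc]
  rw [Matrix.transpose_sub, Matrix.sub_mul, Matrix.mul_sub, Matrix.sub_mul, Matrix.sub_mul, h3, h4,
    h5] at h2
  rw [Matrix.mul_sub, Matrix.sub_mul] at h1
  simp only [Matrix.trace_sub, Matrix.mul_smul, Matrix.smul_mul, Matrix.mul_one,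
    Matrix.trace_smul, smul_eq_mul] at h1 h2
  rw [frobSq_eq_trace]
  linarith

end BarrierMethod

/-- The row space of a matrix of rank at most `k` lies in the span of `k` orthonormal vectors. -/
theorem exists_orthonormal_cols_of_rank_le {m n k : ℕ} (X : Matrix (Fin m) (Fin n) ℝ)
    (hX : X.rank ≤ k) (hkn : k ≤ n) :
    ∃ V : Matrix (Fin n) (Fin k) ℝ, Vᵀ * V = 1 ∧ X * V * Vᵀ = X := by
  let e := (WithLp.linearEquiv 2 ℝ (Fin n → ℝ)).symm
  let W : Submodule ℝ (EuclideanSpace ℝ (Fin n)) :=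
    (Submodule.span ℝ (Set.range X.row)).map (e : (Fin n → ℝ) →ₗ[ℝ] EuclideanSpace ℝ (Fin n))
  have hW : Module.finrank ℝ W ≤ k := by
    rw [LinearEquiv.finrank_map_eq, ← Matrix.rank_eq_finrank_span_row]
    exact hX
  set d := Module.finrank ℝ W
  let w := stdOrthonormalBasis ℝ W
  let v : Fin n → EuclideanSpace ℝ (Fin n) := fun i => if h : i.1 < d then w ⟨i, h⟩ else 0
  have hv : Orthonormal ℝ (Set.domRestrict {i : Fin n | i.1 < d} v) := by
    have h := (w.orthonormal.comp_linearIsometry W.subtypeₗᵢ).comp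
      (fun i : {i : Fin n | i.1 < d} => (⟨i.1, i.2⟩ : Fin d))
      (fun i j hij => Subtype.ext (Fin.ext (by simpa using hij)))
    convert h using 1
    funext i
    exact dif_pos i.2
  obtain ⟨b, hb⟩ := hv.exists_orthonormalBasis_extension_of_card_eq (by simp)
  have hrow : ∀ i, e (X i) ∈ W := fun i =>
    Submodule.mem_map_of_mem (Submodule.subset_span ⟨i, rfl⟩)
  have horth : ∀ i j, k ≤ j.1 → inner ℝ (b j) (e (X i)) = 0 := fun i j hj => by
    have hx := w.sum_repr' ⟨_, hrow i⟩
    have hx' : e (X i) = ∑ l, inner ℝ (w l) ⟨_, hrow i⟩ • (w l : EuclideanSpace ℝ (Fin n)) := by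
      simpa using (congrArg Subtype.val hx).symm
    rw [hx', inner_sum]
    refine Finset.sum_eq_zero fun l _ => ?_
    have hl : b (Fin.castLE (hW.trans hkn) l) = w l := by
      rw [hb _ (by simp)]
      exact dif_pos l.2
    rw [inner_smul_right, ← hl, b.inner_eq_zero, mul_zero]
    exact fun h => absurd (congrArg Fin.val h) (l.2.trans_le (hW.trans hj)).ne'
  have hinner : ∀ i j, inner ℝ (b j) (e (X i)) = ∑ q, X i q * b j q := fun i j => by
    simp [PiLp.inner_apply, e]
  refine ⟨Matrix.of fun p j => b (Fin.castLE hkn j) p, ?_, ?_⟩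
  · ext i j
    have h := orthonormal_iff_ite.1 b.orthonormal (Fin.castLE hkn i) (Fin.castLE hkn j)
    simp only [PiLp.inner_apply, Fin.castLE_inj] at h
    simpa [Matrix.mul_apply, Matrix.one_apply, mul_comm] using h
  · ext i p
    have h := congrArg (fun x : EuclideanSpace ℝ (Fin n) => x p) (b.sum_repr' (e (X i)))
    have hsum : ∑ j, inner ℝ (b j) (e (X i)) * b j p = X i p := by
      simpa [e] using h
    rw [← hsum, Matrix.mul_apply]
    simp only [Matrix.mul_apply, Matrix.of_apply, Matrix.transpose_apply, ← hinner]
    refine Finset.sum_of_injOn (Fin.castLE hkn) (Fin.castLE_injective hkn).injOn (by simp) ?_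
      (by simp)
    intro j _ hj
    rw [horth i j, zero_mul]
    by_contra! hlt
    exact hj ⟨⟨j, hlt⟩, by simp, rfl⟩

theorem frobSq_sub_mul_le {m n k : ℕ} {A X : Matrix (Fin m) (Fin n) ℝ}
    {V : Matrix (Fin n) (Fin k) ℝ} (hV : Vᵀ * V = 1) (hX : X * V * Vᵀ = X) :
    frobSq (A - A * V * Vᵀ) ≤ frobSq (A - X) := by
  have horth : (A - A * V * Vᵀ) * ((X - A) * V * Vᵀ)ᵀ = 0 := by
    have : (A - A * V * Vᵀ) * V = 0 := by
      rw [Matrix.sub_mul, Matrix.mul_assoc _ Vᵀ, hV, Matrix.mul_one, sub_self]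
    rw [Matrix.transpose_mul, Matrix.transpose_transpose, ← Matrix.mul_assoc, this,
      Matrix.zero_mul]
  have h := frobSq_sub_of_mul_transpose_eq_zero horth
  have heq : A - A * V * Vᵀ - (X - A) * V * Vᵀ = A - X := by
    rw [Matrix.sub_mul, Matrix.sub_mul, hX]; abel
  rw [heq] at h
  linarith [frobSq_nonneg ((X - A) * V * Vᵀ)]

theorem mul_diagonal_eq_submatrix_mul {m n r : ℕ} (A : Matrix (Fin m) (Fin n) ℝ) {s : Fin n → ℝ}
    {f : Fin r → Fin n} (hf : Function.Injective f) (hs : ∀ i, s i ≠ 0 → i ∈ Set.range f) :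
    A * diagonal s = A.submatrix id f * (diagonal s).submatrix f id := by
  ext i j
  rw [Matrix.mul_apply, Matrix.mul_apply]
  refine (Finset.sum_of_injOn f hf.injOn (by simp) ?_ (by simp)).symm
  intro l _ hl
  have : s l = 0 := by
    by_contra h
    obtain ⟨p, rfl⟩ := hs l h
    exact hl ⟨p, by simp, rfl⟩
  simp [diagonal_apply, this]

theorem frobSqErrIn_le {m n r : ℕ} {A X : Matrix (Fin m) (Fin n) ℝ} {C : Matrix (Fin m) (Fin r) ℝ}
    {k : ℕ} (hX : X.rank ≤ k) (hC : LinearMap.range X.mulVecLin ≤ LinearMap.range C.mulVecLin) :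
    frobSqErrIn A C k ≤ frobSq (A - X) :=
  csInf_le ⟨0, by rintro _ ⟨Y, -, -, rfl⟩; exact frobSq_nonneg _⟩ ⟨X, hX, hC, rfl⟩

theorem exists_columns_frobSqErrIn_le {m n : ℕ} (A X : Matrix (Fin m) (Fin n) ℝ) {k r : ℕ}
    (hk : 1 ≤ k) (hX : X.rank ≤ k) (hkr : k < r) (hrn : r ≤ n) :
    ∃ f : Fin r → Fin n, Function.Injective f ∧ frobSqErrIn A (A.submatrix id f) k ≤
      (1 + 1 / (1 - Real.sqrt ((k : ℝ) / (r : ℝ))) ^ 2) * frobSq (A - X) := by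
  obtain ⟨V, hV, hXV⟩ := exists_orthonormal_cols_of_rank_le X hX (hkr.le.trans hrn)
  have hEX := frobSq_sub_mul_le (A := A) hV hXV
  set E := A - A * V * Vᵀ with hE
  have : Nonempty (Fin k) := ⟨⟨0, hk⟩⟩
  have hk0 : (0 : ℝ) < k := by exact_mod_cast hk
  have hr0 : (0 : ℝ) < r := by exact_mod_cast hk.trans hkr.le
  have hkr' : (k : ℝ) / r < 1 := (div_lt_one hr0).2 (by exact_mod_cast hkr)
  set φ := Real.sqrt ((k : ℝ) / r) with hφdef
  have hφ0 : 0 < φ := Real.sqrt_pos.2 (by positivity)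
  have hφ1 : φ < 1 := by rw [hφdef, Real.sqrt_lt' one_pos]; simpa using hkr'
  have hφsq : φ ^ 2 * r = k := by
    rw [hφdef, Real.sq_sqrt (by positivity)]; field_simp
  obtain ⟨s, hs, hcard, hpd, -, hsum⟩ := exists_barrier_weights hV
    (a := fun i => ∑ p, E p i ^ 2) (fun i => Finset.sum_nonneg fun _ _ => sq_nonneg _)
    hφ1 (mul_pos hr0 hφ0)
    (by rw [Fintype.card_fin, ← hφsq, div_le_iff₀ (by positivity)]; exact le_of_eq (by ring)) r
  obtain ⟨S, hSs, -, hScard⟩ := Finset.exists_subsuperset_card_eq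
    (Finset.subset_univ (Finset.univ.filter fun i => s i ≠ 0)) hcard (by simpa using hrn)
  set f := S.orderEmbOfFin hScard
  refine ⟨f, f.injective, ?_⟩
  have hsf : ∀ i, s i ≠ 0 → i ∈ Set.range f := fun i hi => by
    rw [Finset.range_orderEmbOfFin]
    exact hSs (by simpa using hi)
  set l := r * (1 - φ) with hldef
  have hl : 0 < l := mul_pos hr0 (by linarith)
  set G := Vᵀ * diagonal s * V with hGdef
  have hG : (G - l • (1 : Matrix (Fin k) (Fin k) ℝ)).PosDef := by
    have : G - l • (1 : Matrix (Fin k) (Fin k) ℝ) = (r * φ - r) • 1 + G := by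
      rw [hldef]; module
    rwa [this]
  have hGpd : G.PosDef := by
    have := hG.add (Matrix.PosDef.one.smul hl)
    simpa using this
  have hGG : G * G⁻¹ = 1 :=
    Matrix.mul_nonsing_inv G ((Matrix.isUnit_iff_isUnit_det _).1 hGpd.isUnit)
  have hreg := frobSq_mul_diagonal_mul_inv_le hs hl hG.posSemidef E
  rw [← hGdef] at hreg
  set W := E * diagonal s * V * G⁻¹ with hW
  have hEV : E * V = 0 := by
    rw [hE, Matrix.sub_mul, Matrix.mul_assoc _ Vᵀ, hV, Matrix.mul_one, sub_self]
  have htrE : (E * diagonal s * Eᵀ).trace = ∑ i, s i * ∑ p, E p i ^ 2 := by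
    simp only [Matrix.trace, Matrix.diag_apply, Matrix.mul_apply (N := Eᵀ), Matrix.mul_diagonal,
      Matrix.transpose_apply, Finset.mul_sum]
    rw [Finset.sum_comm]
    exact Finset.sum_congr rfl fun _ _ => Finset.sum_congr rfl fun _ _ => by ring
  have hfrobE : ∑ i, ∑ p, E p i ^ 2 = frobSq E := Finset.sum_comm
  rw [hfrobE] at hsum
  rw [htrE] at hreg
  have hfrobW : frobSq (W * Vᵀ) = frobSq W := by
    rw [frobSq_eq_trace, frobSq_eq_trace, Matrix.transpose_mul, Matrix.transpose_transpose,
      Matrix.mul_assoc, ← Matrix.mul_assoc Vᵀ, hV, Matrix.one_mul]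
  set Y := A * diagonal s * V * G⁻¹ * Vᵀ with hY
  have hAY : A - Y = E - W * Vᵀ := by
    have hA : A = E + A * V * Vᵀ := by rw [hE]; abel
    have h1 : A * V * Vᵀ * diagonal s * V * G⁻¹ = A * V := by
      calc _ = A * V * (G * G⁻¹) := by rw [hGdef]; simp only [Matrix.mul_assoc]
        _ = A * V := by rw [hGG, Matrix.mul_one]
    have h2 : Y = W * Vᵀ + A * V * Vᵀ := by
      rw [hY, hW]
      nth_rw 1 [hA]
      simp only [Matrix.add_mul, h1]
    rw [h2, hE]; abel
  have hbound : frobSqErrIn A (A.submatrix id f) k ≤ frobSq (A - Y) := by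
    refine frobSqErrIn_le ?_ ?_
    · exact (Matrix.rank_mul_le_right _ _).trans (by simpa using Matrix.rank_le_card_height Vᵀ)
    · rw [hY, mul_diagonal_eq_submatrix_mul A f.injective hsf]
      simp only [Matrix.mul_assoc, Matrix.mulVecLin_mul]
      exact LinearMap.range_comp_le_range _ _
  rw [hAY, frobSq_sub_of_mul_transpose_eq_zero (by
    rw [Matrix.transpose_mul, Matrix.transpose_transpose, ← Matrix.mul_assoc, hEV,
      Matrix.zero_mul]), hfrobW] at hbound
  have hWE : frobSq W ≤ 1 / (1 - φ) ^ 2 * frobSq E := by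
    have h1φ : 0 < 1 - φ := by linarith
    rw [one_div, ← div_eq_inv_mul, le_div_iff₀ (by positivity)]
    refine le_of_mul_le_mul_left ?_ hr0
    calc r * (frobSq W * (1 - φ) ^ 2) = l * frobSq W * (1 - φ) := by rw [hldef]; ring
      _ ≤ _ := (mul_le_mul_of_nonneg_right hreg h1φ.le).trans hsum
  calc _ ≤ (1 + 1 / (1 - φ) ^ 2) * frobSq E := by linarith
    _ ≤ _ := mul_le_mul_of_nonneg_left hEX (by positivity)

/-- **Deterministic Frobenius norm reconstruction** (Theorem 2 of
Boutsidis–Drineas–Magdon-Ismail): for any real `m × n` matrix `A` of rank `ρ`, any target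
rank `k` with `1 ≤ k < ρ`, and any `r` with `k < r ≤ n`, there exist `r` columns of `A`
forming a matrix `C` such that
`‖A - Π^F_{C,k}(A)‖_F² ≤ (1 + 1/(1 - √(k/r))²) ‖A - A_k‖_F²`. -/
theorem frobenius_norm_column_reconstruction
    {m n : ℕ} (A : Matrix (Fin m) (Fin n) ℝ) (k : ℕ)
    (hk1 : 1 ≤ k) (hk : k < A.rank) (r : ℕ) (hkr : k < r) (hrn : r ≤ n) :
    ∃ f : Fin r → Fin n, Function.Injective f ∧
      frobSqErrIn A (A.submatrix id f) k ≤
        (1 + 1 / (1 - Real.sqrt ((k : ℝ) / (r : ℝ))) ^ 2) * frobSqErr A k := by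
  classical
  let S : Finset (Fin r → Fin n) := Finset.univ.filter Function.Injective
  have hS : S.Nonempty := ⟨Fin.castLE hrn, by simpa [S] using Fin.castLE_injective hrn⟩
  obtain ⟨f, hf, hmin⟩ := S.exists_min_image (fun f => frobSqErrIn A (A.submatrix id f) k) hS
  refine ⟨f, by simpa [S] using hf, ?_⟩
  have hc : 0 < 1 + 1 / (1 - Real.sqrt ((k : ℝ) / (r : ℝ))) ^ 2 := by positivity
  rw [← div_le_iff₀' hc]
  refine le_csInf ⟨_, 0, by simp, rfl⟩ ?_
  rintro _ ⟨X, hX, rfl⟩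
  obtain ⟨g, hg, hgX⟩ := exists_columns_frobSqErrIn_le A X hk1 hX hkr hrn
  rw [div_le_iff₀' hc]
  exact (hmin g (by simpa [S] using hg)).trans hgX
end

section
/- Let A be a real m×n matrix of rank ρ, let k be an integer with 2 ≤ k < ρ, and let ε ∈ (0,1). Then there exists a matrix C whose columns are at most 100k + ⌈3k/ε⌉ columns of A such that ‖A − Π^F_{C,k}(A)‖_F² ≤ (1 + ε) · ‖A − A_k‖_F². -/
open Matrix MeasureTheory

theorem frobSq_eq_trace_s3 {m n : Type*} [Fintype m] [Fintype n] (A : Matrix m n ℝ) :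
    frobSq A = (Aᵀ * A).trace := by
  simp only [frobSq, trace, diag_apply, mul_apply, transpose_apply]
  rw [Finset.sum_comm]
  simp only [sq]

theorem frobSq_nonneg_s3 {m n : Type*} [Fintype m] [Fintype n] (A : Matrix m n ℝ) :
    0 ≤ frobSq A :=
  Finset.sum_nonneg fun _ _ => Finset.sum_nonneg fun _ _ => sq_nonneg _

theorem frobSq_transpose {m n : Type*} [Fintype m] [Fintype n] (A : Matrix m n ℝ) :
    frobSq Aᵀ = frobSq A :=
  Finset.sum_comm

theorem frobSq_add {m n : Type*} [Fintype m] [Fintype n] (A B : Matrix m n ℝ) :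
    frobSq (A + B) = frobSq A + 2 * (Aᵀ * B).trace + frobSq B := by
  have h : (Bᵀ * A).trace = (Aᵀ * B).trace := by
    rw [← trace_transpose, transpose_mul, transpose_transpose]
  simp only [frobSq_eq_trace_s3, transpose_add, Matrix.add_mul, Matrix.mul_add, trace_add, h]
  ring

/-- The orthogonal projection onto the column space of a matrix with independent columns. -/
noncomputable def colProj {m r : Type*} [Fintype m] [Fintype r] [DecidableEq r]
    (C : Matrix m r ℝ) : Matrix m m ℝ :=
  C * (Cᵀ * C)⁻¹ * Cᵀ

section colProj

variable {m r : Type*} [Fintype m] [Fintype r] [DecidableEq r] {C : Matrix m r ℝ}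

theorem gram_inv_transpose (C : Matrix m r ℝ) : ((Cᵀ * C)⁻¹)ᵀ = (Cᵀ * C)⁻¹ := by
  rw [transpose_nonsing_inv, transpose_mul, transpose_transpose]

theorem colProj_transpose (C : Matrix m r ℝ) : (colProj C)ᵀ = colProj C := by
  simp [colProj, Matrix.mul_assoc, gram_inv_transpose]

theorem colProj_mul_self (h : IsUnit (Cᵀ * C).det) : colProj C * C = C := by
  rw [colProj, Matrix.mul_assoc, Matrix.mul_assoc, nonsing_inv_mul _ h, Matrix.mul_one]

theorem colProj_idem (h : IsUnit (Cᵀ * C).det) : colProj C * colProj C = colProj C := by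
  conv_lhs => rhs; rw [colProj]
  rw [← Matrix.mul_assoc, ← Matrix.mul_assoc, colProj_mul_self h, colProj]

theorem trace_colProj (h : IsUnit (Cᵀ * C).det) : (colProj C).trace = Fintype.card r := by
  rw [colProj, Matrix.mul_assoc, trace_mul_comm, Matrix.mul_assoc, nonsing_inv_mul _ h, trace_one]

end colProj

theorem exists_projection {m n : Type*} [Fintype m] [Fintype n] [DecidableEq n]
    (X : Matrix m n ℝ) :
    ∃ P : Matrix m m ℝ, Pᵀ = P ∧ P * P = P ∧ P * X = X ∧ P.trace = X.rank ∧ P.rank ≤ X.rank := by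
  obtain ⟨d, b, hd⟩ : ∃ (d : ℕ) (_ : Module.Basis (Fin d) ℝ (LinearMap.range X.mulVecLin)),
      d = X.rank := ⟨_, Module.finBasis ℝ _, rfl⟩
  let C : Matrix m (Fin d) ℝ := of fun i l => (b l : m → ℝ) i
  have hCmul : ∀ y, C *ᵥ y = ((∑ l, y l • b l : LinearMap.range X.mulVecLin) : m → ℝ) := by
    intro y
    ext i
    simp [C, mulVec, dotProduct, mul_comm]
  have hinj : Function.Injective C.mulVec := by
    intro y z hyz
    rw [hCmul, hCmul, SetLike.coe_eq_coe] at hyz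
    rw [← b.equivFun_symm_apply, ← b.equivFun_symm_apply] at hyz
    exact b.equivFun.symm.injective hyz
  have hdet : IsUnit (Cᵀ * C).det := by
    have := (PosDef.conjTranspose_mul_self C hinj).det_pos
    rw [conjTranspose_eq_transpose_of_trivial] at this
    exact this.ne'.isUnit
  have hX : ∃ Y : Matrix (Fin d) n ℝ, C * Y = X := by
    refine ⟨of fun l j => b.equivFun ⟨X *ᵥ Pi.single j 1, _, rfl⟩ l, ?_⟩
    ext i j
    have h := hCmul (b.equivFun ⟨X *ᵥ Pi.single j 1, _, rfl⟩)
    rw [b.sum_equivFun] at h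
    have h' := congrFun h i
    exact h'.trans (congrFun (mulVec_single_one X j) i)
  obtain ⟨Y, hY⟩ := hX
  refine ⟨colProj C, colProj_transpose C, colProj_idem hdet, ?_, ?_, ?_⟩
  · calc colProj C * X = colProj C * (C * Y) := by rw [hY]
      _ = X := by rw [← Matrix.mul_assoc, colProj_mul_self hdet, hY]
  · rw [trace_colProj hdet, Fintype.card_fin, hd]
  · rw [colProj, Matrix.mul_assoc, ← hd]
    exact (rank_mul_le_left _ _).trans
      (C.rank_le_card_width.trans_eq (Fintype.card_fin d))

section projection

variable {m n : Type*} [Fintype m] [Fintype n] {P : Matrix m m ℝ}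

theorem frobSq_eq_add_of_projection (hPt : Pᵀ = P) (hP : P * P = P) (B : Matrix m n ℝ) :
    frobSq B = frobSq (P * B) + frobSq (B - P * B) := by
  have h := frobSq_add (P * B) (B - P * B)
  have h0 : (P * B)ᵀ * (B - P * B) = 0 := by
    rw [transpose_mul, hPt, Matrix.mul_assoc, Matrix.mul_sub, ← Matrix.mul_assoc P P, hP]
    simp
  rwa [h0, trace_zero, add_sub_cancel, mul_zero, add_zero] at h

theorem frobSq_sub_projection_le (hPt : Pᵀ = P) (hP : P * P = P) {A X : Matrix m n ℝ}
    (hX : P * X = X) : frobSq (A - P * A) ≤ frobSq (A - X) := by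
  have h := frobSq_eq_add_of_projection hPt hP (A - X)
  have e : A - X - P * (A - X) = A - P * A := by
    rw [Matrix.mul_sub, hX]; abel
  rw [e] at h
  linarith [frobSq_nonneg_s3 (P * (A - X))]

theorem trace_mul_projection_le {Q : Matrix m m ℝ} (hPt : Pᵀ = P) (hP : P * P = P)
    (hQt : Qᵀ = Q) (hQ : Q * Q = Q) : (P * Q).trace ≤ P.trace := by
  have h := frobSq_eq_add_of_projection hQt hQ P
  have h1 := frobSq_nonneg_s3 (P - Q * P)
  have h2 : frobSq (Q * P) = (P * Q).trace := by
    rw [frobSq_eq_trace_s3, transpose_mul, hPt, hQt, Matrix.mul_assoc, ← Matrix.mul_assoc Q, hQ,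
      ← Matrix.mul_assoc, trace_mul_comm, ← Matrix.mul_assoc, hP]
  have h3 : frobSq P = P.trace := by rw [frobSq_eq_trace_s3, hPt, hP]
  linarith

end projection

theorem le_sum_gram_inv_mul {m r : Type*} [Fintype m] [Fintype r] [DecidableEq r]
    {C : Matrix m r ℝ} {P : Matrix m m ℝ} (hPt : Pᵀ = P) (hP : P * P = P)
    (h : IsUnit (Cᵀ * C).det) :
    (Fintype.card r : ℝ) - 2 * P.trace ≤
      ∑ j, (Cᵀ * C)⁻¹ j j * ∑ i, (C - P * C) i j ^ 2 := by
  set H := (Cᵀ * C)⁻¹ with hH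
  set B := C - P * C with hB
  have hHt : Hᵀ = H := gram_inv_transpose C
  have hU : (C * H)ᵀ * (C * H) = H := by
    rw [transpose_mul, hHt, Matrix.mul_assoc, ← Matrix.mul_assoc Cᵀ, hH, mul_nonsing_inv _ h,
      Matrix.mul_one]
  have hterm : ∀ j, 2 * ((C * H)ᵀ * B) j j - 1 ≤ H j j * ∑ i, B i j ^ 2 := by
    intro j
    have h1 : H j j = ∑ i, (C * H) i j ^ 2 := by
      conv_lhs => rw [← hU]
      rw [mul_apply]
      simp only [transpose_apply, sq]
    have h2 : ((C * H)ᵀ * B) j j = ∑ i, (C * H) i j * B i j := by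
      rw [mul_apply]
      simp only [transpose_apply]
    rw [h1, h2]
    refine le_trans ?_ (Finset.sum_mul_sq_le_sq_mul_sq Finset.univ _ _)
    nlinarith [sq_nonneg (∑ i, (C * H) i j * B i j - 1)]
  have htr : ((C * H)ᵀ * B).trace = Fintype.card r - (P * colProj C).trace := by
    rw [hB, Matrix.mul_sub, trace_sub, transpose_mul, hHt, Matrix.mul_assoc H Cᵀ C,
      hH, nonsing_inv_mul _ h, trace_one, ← Matrix.mul_assoc, trace_mul_comm, colProj,
      ← Matrix.mul_assoc, ← Matrix.mul_assoc, ← Matrix.mul_assoc, ← Matrix.mul_assoc]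
    congr 1
    rw [← hH, trace_mul_comm (P * C * H), trace_mul_comm (C * H * Cᵀ)]
    simp only [Matrix.mul_assoc]
    rw [trace_mul_comm Cᵀ]
    simp only [Matrix.mul_assoc]
  have hle := trace_mul_projection_le hPt hP (colProj_transpose C) (colProj_idem h)
  have hsum := Finset.sum_le_sum fun j (_ : j ∈ Finset.univ) => hterm j
  rw [Finset.sum_sub_distrib, ← Finset.mul_sum] at hsum
  simp only [Finset.sum_const, Finset.card_univ, nsmul_eq_mul, mul_one] at hsum
  have htr' : ∑ j, ((C * H)ᵀ * B) j j = ((C * H)ᵀ * B).trace := rfl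
  rw [htr', htr] at hsum
  linarith

/-- The Gram determinant of the columns of `A` listed by `g`. -/
noncomputable def gramDet {m n : Type*} [Fintype m] {r : ℕ} (A : Matrix m n ℝ) (g : Fin r → n) :
    ℝ :=
  ((A.submatrix id g)ᵀ * A.submatrix id g).det

section gramDet

variable {m n : Type*} [Fintype m] {r : ℕ} {A : Matrix m n ℝ}

theorem gramDet_nonneg (A : Matrix m n ℝ) (g : Fin r → n) : 0 ≤ gramDet A g := by
  have := (posSemidef_conjTranspose_mul_self (A.submatrix id g)).det_nonneg
  rwa [conjTranspose_eq_transpose_of_trivial] at this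

theorem adjugate_gram_diag (A : Matrix m n ℝ) (g : Fin (r + 1) → n) (j : Fin (r + 1)) :
    adjugate ((A.submatrix id g)ᵀ * A.submatrix id g) j j = gramDet A (g ∘ j.succAbove) := by
  rw [adjugate_fin_succ_eq_det_submatrix, Even.neg_one_pow ⟨_, rfl⟩, one_mul]
  rfl

theorem gramDet_cons {g : Fin r → n} (h : 0 < gramDet A g) (j : n) :
    gramDet A (Fin.cons j g : Fin (r + 1) → n) =
      gramDet A g * ∑ i, (A - colProj (A.submatrix id g) * A) i j ^ 2 := by
  set C := A.submatrix id g
  set C' := A.submatrix id (Fin.cons j g : Fin (r + 1) → n)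
  have hu : IsUnit (Cᵀ * C).det := h.ne'.isUnit
  let a : m → ℝ := fun i => A i j
  let y : Fin r → ℝ := (Cᵀ * C)⁻¹ *ᵥ (Cᵀ *ᵥ a)
  let e : m → ℝ := a - colProj C *ᵥ a
  let v : Fin (r + 1) → ℝ := Fin.cons 1 (-y)
  have hv : C' *ᵥ v = e := by
    have hy : C *ᵥ y = colProj C *ᵥ a := by simp [y, colProj, mulVec_mulVec, Matrix.mul_assoc]
    simp only [e]
    rw [← hy]
    ext i
    simp [mulVec, dotProduct, Fin.sum_univ_succ, v, C', C, a, sub_eq_add_neg]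
  have hCe : Cᵀ *ᵥ e = 0 := by
    have : Cᵀ * colProj C = Cᵀ := by
      have := congrArg transpose (colProj_mul_self hu)
      rwa [transpose_mul, colProj_transpose] at this
    simp only [e]
    rw [mulVec_sub, mulVec_mulVec, this, sub_self]
  have hee : a ⬝ᵥ e = ∑ i, (A - colProj C * A) i j ^ 2 := by
    have h0 : (colProj C *ᵥ a) ⬝ᵥ e = 0 := by
      rw [colProj, Matrix.mul_assoc, ← mulVec_mulVec, dotProduct_comm, dotProduct_mulVec,
        ← mulVec_transpose, hCe, zero_dotProduct]
    have h1 : a ⬝ᵥ e = e ⬝ᵥ e := by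
      conv_rhs => lhs; simp only [e]
      rw [sub_dotProduct, h0, sub_zero]
    rw [h1]
    simp only [dotProduct, ← sq]
    rfl
  have hG : (C'ᵀ * C') *ᵥ v = Pi.single 0 (a ⬝ᵥ e) := by
    rw [← mulVec_mulVec, hv]
    ext l
    refine Fin.cases ?_ (fun l => ?_) l
    · rfl
    · rw [Pi.single_eq_of_ne (Fin.succ_ne_zero l)]
      exact congrFun hCe l
  have hadj := congrArg (fun w => (adjugate (C'ᵀ * C') *ᵥ w) 0) hG
  simp only [mulVec_mulVec, adjugate_mul, smul_mulVec, one_mulVec] at hadj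
  rw [mulVec_single, Pi.smul_apply, Pi.smul_apply, col_apply, adjugate_gram_diag, hee,
    op_smul_eq_mul, smul_eq_mul] at hadj
  exact (mul_one _).symm.trans hadj

theorem le_sum_gramDet {P : Matrix m m ℝ} (hPt : Pᵀ = P) (hP : P * P = P) (A : Matrix m n ℝ)
    (f : Fin (r + 1) → n) :
    (((r + 1 : ℕ) : ℝ) - 2 * P.trace) * gramDet A f ≤
      ∑ j, gramDet A (f ∘ j.succAbove) * ∑ i, (A - P * A) i (f j) ^ 2 := by
  rcases (gramDet_nonneg A f).eq_or_lt with h | h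
  · rw [← h, mul_zero]
    exact Finset.sum_nonneg fun j _ => mul_nonneg (gramDet_nonneg A _)
      (Finset.sum_nonneg fun i _ => sq_nonneg _)
  · have hu : IsUnit ((A.submatrix id f)ᵀ * A.submatrix id f).det := h.ne'.isUnit
    have hle := mul_le_mul_of_nonneg_right (le_sum_gram_inv_mul hPt hP hu) h.le
    rw [Fintype.card_fin, Finset.sum_mul] at hle
    refine hle.trans_eq (Finset.sum_congr rfl fun j _ => ?_)
    have hinv : ((A.submatrix id f)ᵀ * A.submatrix id f)⁻¹ j j * gramDet A f =
        gramDet A (f ∘ j.succAbove) := by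
      rw [← adjugate_gram_diag, inv_def, Matrix.smul_apply, smul_eq_mul, Ring.inverse_eq_inv', gramDet,
        mul_right_comm, inv_mul_cancel₀ hu.ne_zero, one_mul]
    rw [mul_right_comm, hinv]
    rfl

variable [Fintype n]

theorem sum_gramDet_mul_frobSq_le (A : Matrix m n ℝ) (r : ℕ) :
    ∑ g : Fin r → n, gramDet A g * frobSq (A - colProj (A.submatrix id g) * A) ≤
      ∑ f : Fin (r + 1) → n, gramDet A f := by
  rw [← (Fin.consEquiv fun _ => n).sum_comp, Fintype.sum_prod_type, Finset.sum_comm]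
  refine Finset.sum_le_sum fun g _ => ?_
  rcases (gramDet_nonneg A g).eq_or_lt with h | h
  · rw [← h, zero_mul]
    exact Finset.sum_nonneg fun j _ => gramDet_nonneg A _
  · refine le_of_eq ?_
    rw [frobSq, Finset.sum_comm, Finset.mul_sum]
    exact Finset.sum_congr rfl fun j _ => (gramDet_cons h j).symm

theorem sum_gramDet_succ_le {P : Matrix m m ℝ} (hPt : Pᵀ = P) (hP : P * P = P)
    (A : Matrix m n ℝ) (r : ℕ) :
    (((r + 1 : ℕ) : ℝ) - 2 * P.trace) * ∑ f : Fin (r + 1) → n, gramDet A f ≤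
      ((r + 1 : ℕ) : ℝ) * (frobSq (A - P * A) * ∑ g : Fin r → n, gramDet A g) := by
  rw [Finset.mul_sum]
  refine (Finset.sum_le_sum fun f _ => le_sum_gramDet hPt hP A f).trans_eq ?_
  rw [Finset.sum_comm]
  have key : ∀ j : Fin (r + 1), ∑ f : Fin (r + 1) → n,
      gramDet A (f ∘ j.succAbove) * ∑ i, (A - P * A) i (f j) ^ 2 =
        frobSq (A - P * A) * ∑ g : Fin r → n, gramDet A g := by
    intro j
    rw [← (Fin.insertNthEquiv (fun _ => n) j).sum_comp, Fintype.sum_prod_type, frobSq,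
      Finset.sum_comm (s := (Finset.univ : Finset m)), Finset.sum_mul]
    refine Finset.sum_congr rfl fun a _ => ?_
    rw [Finset.mul_sum]
    refine Finset.sum_congr rfl fun g _ => ?_
    rw [mul_comm]
    simp [Function.comp_def]
  rw [Finset.sum_congr rfl fun j _ => key j]
  simp

theorem exists_frobSq_le_of_sum_gramDet {c : ℝ} (h0 : 0 < ∑ g : Fin r → n, gramDet A g)
    (h : ∑ f : Fin (r + 1) → n, gramDet A f ≤ c * ∑ g : Fin r → n, gramDet A g) :
    ∃ g : Fin r → n, 0 < gramDet A g ∧ frobSq (A - colProj (A.submatrix id g) * A) ≤ c := by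
  by_contra! hcon
  have hle := (sum_gramDet_mul_frobSq_le A r).trans h
  refine hle.not_gt ?_
  rw [Finset.mul_sum]
  obtain ⟨g, -, hg⟩ := Finset.exists_lt_of_sum_lt
    (s := (Finset.univ : Finset (Fin r → n))) (f := fun _ => (0 : ℝ)) (g := fun g => gramDet A g)
    (by simpa using h0)
  refine Finset.sum_lt_sum (fun g' _ => ?_) ⟨g, Finset.mem_univ _, ?_⟩
  · rcases (gramDet_nonneg A g').eq_or_lt with h' | h'
    · rw [← h', zero_mul, mul_zero]
    · rw [mul_comm]
      exact mul_le_mul_of_nonneg_left (hcon g' h').le h'.le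
  · rw [mul_comm]
    exact mul_lt_mul_of_pos_left (hcon g hg) hg

/-- Some at most `3 k` independent columns of `A` capture `A` up to three times the error of the
projection `P` of trace at most `k`. -/
theorem exists_frobSq_sub_colProj_le {P : Matrix m m ℝ} (hPt : Pᵀ = P) (hP : P * P = P)
    (A : Matrix m n ℝ) {k : ℕ} (hk : P.trace ≤ k) :
    ∃ (r : ℕ) (g : Fin r → n), r ≤ 3 * k ∧ 0 < gramDet A g ∧
      frobSq (A - colProj (A.submatrix id g) * A) ≤ 3 * frobSq (A - P * A) := by
  have hD (r : ℕ) : 0 ≤ ∑ g : Fin r → n, gramDet A g :=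
    Finset.sum_nonneg fun g _ => gramDet_nonneg A g
  have hF := frobSq_nonneg_s3 (A - P * A)
  by_cases hall : ∀ r ≤ 3 * k, 0 < ∑ g : Fin r → n, gramDet A g
  · have h := sum_gramDet_succ_le hPt hP A (3 * k)
    obtain ⟨g, hg⟩ := exists_frobSq_le_of_sum_gramDet (c := 3 * frobSq (A - P * A))
      (hall (3 * k) le_rfl) (by
        push_cast at h
        have hF' := mul_nonneg hF (hD (3 * k))
        have hm := mul_nonneg (sub_nonneg.2 hk) (hD (3 * k + 1))
        have hk0 : (0 : ℝ) < k + 1 := by positivity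
        refine le_of_mul_le_mul_left ?_ hk0
        nlinarith)
    exact ⟨_, g, le_rfl, hg⟩
  · push Not at hall
    classical
    obtain ⟨hle, hzero⟩ := Nat.find_spec hall
    have hmin := fun l => Nat.find_min hall (m := l)
    rcases hr : Nat.find hall with _ | r
    · rw [hr] at hzero
      simp [gramDet] at hzero
      linarith
    · rw [hr] at hzero hle hmin
      have hpos : 0 < ∑ g : Fin r → n, gramDet A g := by
        by_contra hneg
        exact hmin r r.lt_succ_self ⟨by omega, not_lt.1 hneg⟩
      obtain ⟨g, hg, hg'⟩ := exists_frobSq_le_of_sum_gramDet (c := 0) hpos (by simpa using hzero)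
      exact ⟨r, g, by omega, hg, by linarith⟩

end gramDet

section sampling

variable {m n : Type*} [Fintype m] [Fintype n]

/-- A derandomized averaging argument: some `s` samples of a weighted family of matrices deviate
from its mean at most as much as independent samples do on average. -/
theorem exists_frobSq_sum_sub_le {ι : Type*} [Fintype ι] {p : ι → ℝ} (hp : ∀ j, 0 ≤ p j)
    (hp1 : ∑ j, p j = 1) {W : ι → Matrix m n ℝ} {V : Matrix m n ℝ} (hV : ∑ j, p j • W j = V)
    {c : ℝ} (hc : ∑ j, p j * frobSq (W j) ≤ c) (s : ℕ) :
    ∃ g : Fin s → ι, frobSq (∑ t, (V - W (g t))) ≤ s * c := by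
  induction s with
  | zero => exact ⟨Fin.elim0, by simp [frobSq]⟩
  | succ s ih =>
    obtain ⟨g, hg⟩ := ih
    set R := ∑ t, (V - W (g t))
    have hsub : ∀ B D : Matrix m n ℝ,
        frobSq (B - D) = frobSq B - 2 * (Bᵀ * D).trace + frobSq D := by
      intro B D
      have h := frobSq_add B (-D)
      have hn : frobSq (-D) = frobSq D := by simp [frobSq]
      rw [hn, Matrix.mul_neg, trace_neg, ← sub_eq_add_neg] at h
      linarith
    have havg : ∑ j, p j * frobSq (V + R - W j) ≤ (s + 1) * c := by
      have h1 : ∑ j, p j * frobSq (V + R - W j) =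
          frobSq (V + R) - 2 * ((V + R)ᵀ * V).trace + ∑ j, p j * frobSq (W j) := by
        simp_rw [hsub (V + R), mul_add, mul_sub]
        rw [Finset.sum_add_distrib, Finset.sum_sub_distrib, ← Finset.sum_mul, hp1, one_mul]
        congr 2
        conv_rhs => rw [← hV, Matrix.mul_sum, trace_sum, Finset.mul_sum, hV]
        refine Finset.sum_congr rfl fun j _ => ?_
        rw [Matrix.mul_smul, trace_smul, smul_eq_mul]
        ring
      have h2 := hsub (V + R) V
      rw [add_sub_cancel_left] at h2
      linarith [frobSq_nonneg_s3 V]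
    obtain ⟨j, hj⟩ : ∃ j, frobSq (V + R - W j) ≤ (s + 1) * c := by
      by_contra! hcon
      obtain ⟨j, -, hj⟩ := Finset.exists_lt_of_sum_lt
        (s := (Finset.univ : Finset ι)) (f := fun _ => (0 : ℝ)) (g := p) (by simp [hp1])
      have hlt : ∑ j, p j * ((s + 1) * c) < ∑ j, p j * frobSq (V + R - W j) :=
        Finset.sum_lt_sum (fun i _ => mul_le_mul_of_nonneg_left (hcon i).le (hp i))
          ⟨j, Finset.mem_univ _, mul_lt_mul_of_pos_left (hcon j) hj⟩
      rw [← Finset.sum_mul, hp1, one_mul] at hlt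
      exact hlt.not_ge havg
    refine ⟨Fin.cons j g, ?_⟩
    rw [Fin.sum_univ_succ]
    simp only [Fin.cons_zero, Fin.cons_succ]
    rw [sub_add_eq_add_sub]
    push_cast
    exact hj

theorem exists_frobSq_sample_le [DecidableEq n] {Q : Matrix n n ℝ} (hQt : Qᵀ = Q) (hQ : Q * Q = Q)
    (E : Matrix m n ℝ) {s : ℕ} (hs : 0 < s) :
    ∃ (s' : ℕ) (g : Fin s' → n) (M : Matrix (Fin s') n ℝ), s' ≤ s ∧
      frobSq ((E - E.submatrix id g * M) * Q) ≤ Q.trace / s * frobSq E := by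
  let x : n → ℝ := fun j => ∑ i, E i j ^ 2
  have hx : ∀ j, 0 ≤ x j := fun j => Finset.sum_nonneg fun _ _ => sq_nonneg _
  have hxF : ∑ j, x j = frobSq E := Finset.sum_comm
  have hxE : ∀ j, x j = 0 → ∀ i, E i j = 0 := by
    intro j hj i
    have := (Finset.sum_eq_zero_iff_of_nonneg fun _ _ => sq_nonneg _).1 hj i (Finset.mem_univ i)
    exact pow_eq_zero_iff two_ne_zero |>.1 this
  have hQd : ∀ j, Q j j = ∑ l, Q j l ^ 2 := by
    intro j
    conv_lhs => rw [← hQ]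
    rw [mul_apply]
    refine Finset.sum_congr rfl fun l _ => ?_
    rw [sq, show Q l j = Q j l from congrFun (congrFun hQt j) l]
  rcases (frobSq_nonneg_s3 E).eq_or_lt with hF | hF
  · have hE : E = 0 := by
      ext i j
      refine hxE j ?_ i
      exact (Finset.sum_eq_zero_iff_of_nonneg fun j _ => hx j).1 (hxF.trans hF.symm) j
        (Finset.mem_univ j)
    exact ⟨0, Fin.elim0, 0, Nat.zero_le _, by simp [hE, frobSq]⟩
  let p : n → ℝ := fun j => x j / frobSq E
  let W : n → Matrix m n ℝ := fun j => of fun i l => (p j)⁻¹ * E i j * Q j l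
  have hp : ∀ j, 0 ≤ p j := fun j => div_nonneg (hx j) hF.le
  have hp1 : ∑ j, p j = 1 := by
    simp only [p]
    rw [← Finset.sum_div, hxF, div_self hF.ne']
  have hpE : ∀ i j, p j * ((p j)⁻¹ * E i j) = E i j := by
    intro i j
    by_cases h : x j = 0
    · simp [hxE j h i]
    · have : p j ≠ 0 := div_ne_zero h hF.ne'
      field_simp
  have hV : ∑ j, p j • W j = E * Q := by
    ext i l
    rw [Matrix.sum_apply, mul_apply]
    refine Finset.sum_congr rfl fun j _ => ?_
    simp only [W, Matrix.smul_apply, of_apply, smul_eq_mul]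
    rw [← mul_assoc, hpE]
  have hc : ∑ j, p j * frobSq (W j) ≤ frobSq E * Q.trace := by
    rw [trace, Finset.mul_sum]
    refine Finset.sum_le_sum fun j _ => ?_
    have hW : frobSq (W j) = (p j)⁻¹ ^ 2 * x j * Q j j := by
      simp only [frobSq, W, of_apply, mul_pow, x, hQd j]
      simp only [← Finset.mul_sum, ← Finset.sum_mul]
    rw [hW, diag_apply]
    have hQn : 0 ≤ Q j j := hQd j ▸ Finset.sum_nonneg fun _ _ => sq_nonneg _
    by_cases h : x j = 0
    · simp only [h, mul_zero, zero_mul]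
      exact mul_nonneg hF.le hQn
    · refine le_of_eq ?_
      simp only [p]
      field_simp
  obtain ⟨g, hg⟩ := exists_frobSq_sum_sub_le hp hp1 hV hc s
  have hs0 : (s : ℝ) ≠ 0 := by positivity
  refine ⟨s, g, of fun t l => if g t = l then (s : ℝ)⁻¹ * (p (g t))⁻¹ else 0, le_rfl, ?_⟩
  set M : Matrix (Fin s) n ℝ := of fun t l => if g t = l then (s : ℝ)⁻¹ * (p (g t))⁻¹ else 0
    with hM
  have hMQ : (E - E.submatrix id g * M) * Q = (s : ℝ)⁻¹ • ∑ t, (E * Q - W (g t)) := by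
    have h1 : E.submatrix id g * M * Q = (s : ℝ)⁻¹ • ∑ t, W (g t) := by
      ext i l
      rw [Matrix.mul_assoc, mul_apply, Matrix.smul_apply, Matrix.sum_apply, smul_eq_mul,
        Finset.mul_sum]
      refine Finset.sum_congr rfl fun t _ => ?_
      rw [mul_apply]
      simp only [hM, W, of_apply, submatrix_apply, id, ite_mul, zero_mul, Finset.sum_ite_eq,
        Finset.mem_univ, if_true]
      ring
    rw [Matrix.sub_mul, h1, Finset.sum_sub_distrib, smul_sub, Finset.sum_const, Finset.card_univ,
      Fintype.card_fin, ← Nat.cast_smul_eq_nsmul ℝ, smul_smul, inv_mul_cancel₀ hs0, one_smul]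
  have hsm : ∀ (a : ℝ) (B : Matrix m n ℝ), frobSq (a • B) = a ^ 2 * frobSq B := by
    intro a B
    simp only [frobSq, Matrix.smul_apply, smul_eq_mul, mul_pow, Finset.mul_sum]
  rw [hMQ, hsm]
  refine (mul_le_mul_of_nonneg_left hg (sq_nonneg _)).trans_eq ?_
  field_simp

end sampling

theorem range_submatrix_comp_le {m n r t : Type*} [Fintype r] [Fintype t] [DecidableEq r]
    (A : Matrix m n ℝ) (f : r → n) (h : t → r) :
    LinearMap.range (A.submatrix id (f ∘ h)).mulVecLin ≤
      LinearMap.range (A.submatrix id f).mulVecLin := by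
  have e : A.submatrix id (f ∘ h) = A.submatrix id f * (1 : Matrix r r ℝ).submatrix id h := by
    ext i j
    simp [mul_apply, one_apply]
  rw [e, mulVecLin_mul]
  exact LinearMap.range_comp_le_range _ _

theorem exists_frobSqErrIn_le {m n : Type*} [Fintype m] [Fintype n]
    (A X : Matrix m n ℝ) {k s : ℕ} (hX : X.rank ≤ k) (hs : 0 < s) {ε : ℝ}
    (hε : 3 * (k : ℝ) / s ≤ ε) :
    ∃ (r : ℕ) (f : Fin r → n), r ≤ 3 * k + s ∧
      frobSqErrIn A (A.submatrix id f) k ≤ (1 + ε) * frobSq (A - X) := by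
  classical
  obtain ⟨P, hPt, hP, hPX, hPtr, -⟩ := exists_projection X
  obtain ⟨Q, hQt, hQ, hQX, hQtr, hQr⟩ := exists_projection Xᵀ
  rw [rank_transpose] at hQtr hQr
  have hXk : (X.rank : ℝ) ≤ k := by exact_mod_cast hX
  obtain ⟨r, g₁, hr, hg₁, hE⟩ := exists_frobSq_sub_colProj_le hPt hP A (hPtr.trans_le hXk)
  set C₁ := A.submatrix id g₁
  set E := A - colProj C₁ * A with hEdef
  obtain ⟨s', g₂, M, hs', hM⟩ := exists_frobSq_sample_le hQt hQ E hs
  set f := Fin.append g₁ g₂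
  set S := LinearMap.range (A.submatrix id f).mulVecLin
  have hS₁ : ∀ w, C₁ *ᵥ w ∈ S := by
    have h := range_submatrix_comp_le A f (Fin.castAdd s')
    rw [show f ∘ Fin.castAdd s' = g₁ from funext fun i => Fin.append_left g₁ g₂ i] at h
    exact fun w => h ⟨w, rfl⟩
  have hS₂ : ∀ w, A.submatrix id g₂ *ᵥ w ∈ S := by
    have h := range_submatrix_comp_le A f (Fin.natAdd r)
    rw [show f ∘ Fin.natAdd r = g₂ from funext fun i => Fin.append_right g₁ g₂ i] at h
    exact fun w => h ⟨w, rfl⟩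
  have hSP : ∀ w, colProj C₁ *ᵥ w ∈ S := by
    intro w
    rw [colProj, Matrix.mul_assoc, ← mulVec_mulVec]
    exact hS₁ _
  have hEg : E.submatrix id g₂ = A.submatrix id g₂ - colProj C₁ * A.submatrix id g₂ := rfl
  set Y := (colProj C₁ * A + E.submatrix id g₂ * M) * Q with hY
  have hYS : LinearMap.range Y.mulVecLin ≤ S := by
    rintro _ ⟨w, rfl⟩
    rw [mulVecLin_apply, hY, ← mulVec_mulVec, add_mulVec, ← mulVec_mulVec, ← mulVec_mulVec, hEg,
      sub_mulVec, ← mulVec_mulVec]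
    exact S.add_mem (hSP _) (S.sub_mem (hS₂ _) (hSP _))
  have hYr : Y.rank ≤ k := (rank_mul_le_right _ _).trans (hQr.trans hX)
  have hYQ : Y * Q = Y := by rw [hY, Matrix.mul_assoc, hQ]
  have herr : frobSq (A - Y) =
      frobSq ((E - E.submatrix id g₂ * M) * Q) + frobSq (A - A * Q) := by
    have h := frobSq_eq_add_of_projection hQt hQ (A - Y)ᵀ
    have h1 : Q * (A - Y)ᵀ = ((A - Y) * Q)ᵀ := by rw [transpose_mul, hQt]
    rw [h1, ← transpose_sub, frobSq_transpose, frobSq_transpose, frobSq_transpose, Matrix.sub_mul,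
      hYQ, sub_sub_sub_cancel_right] at h
    rw [h]
    congr 2
    rw [hY, hEdef]
    simp only [Matrix.sub_mul, Matrix.add_mul]
    abel
  have hAQ : frobSq (A - A * Q) ≤ frobSq (A - X) := by
    have h := frobSq_sub_projection_le hQt hQ (A := Aᵀ) hQX
    rwa [← transpose_sub, frobSq_transpose, ← hQt, ← transpose_mul, ← transpose_sub,
      frobSq_transpose] at h
  have hAP := frobSq_sub_projection_le hPt hP (A := A) hPX
  have hs0 : (0 : ℝ) < s := by exact_mod_cast hs
  have hfin : frobSq (A - Y) ≤ (1 + ε) * frobSq (A - X) := by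
    have hF := frobSq_nonneg_s3 (A - X)
    have h1 : Q.trace / s * frobSq E ≤ k / s * (3 * frobSq (A - X)) := by
      refine mul_le_mul ?_ (hE.trans (by linarith)) (frobSq_nonneg_s3 E) (by positivity)
      exact div_le_div_of_nonneg_right (hQtr.trans_le hXk) hs0.le
    have h2 : (k : ℝ) / s * (3 * frobSq (A - X)) = 3 * (k : ℝ) / s * frobSq (A - X) := by ring
    have h3 := mul_le_mul_of_nonneg_right hε hF
    linarith
  refine ⟨r + s', f, by omega, le_trans (csInf_le ⟨0, ?_⟩ ⟨Y, hYr, hYS, rfl⟩) hfin⟩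
  rintro _ ⟨Z, -, -, rfl⟩
  exact frobSq_nonneg_s3 _

/-- **Relative-error Frobenius norm column reconstruction with `O(k/ε)` columns**
(Theorem 5 of Boutsidis–Drineas–Magdon-Ismail, derandomized form): for any real `m × n`
matrix `A` of rank `ρ`, any target rank `k` with `2 ≤ k < ρ`, and any `0 < ε < 1`, there
exists a matrix `C` whose columns are at most `100 k + ⌈3 k / ε⌉` columns of `A` such that
`‖A - Π^F_{C,k}(A)‖_F² ≤ (1 + ε) ‖A - A_k‖_F²`. -/
theorem relative_error_frobenius_column_reconstruction
    {m n : ℕ} (A : Matrix (Fin m) (Fin n) ℝ) (k : ℕ)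
    (hk2 : 2 ≤ k) (hk : k < A.rank) (ε : ℝ) (hε0 : 0 < ε) (hε1 : ε < 1) :
    ∃ (r : ℕ) (f : Fin r → Fin n),
      r ≤ 100 * k + ⌈3 * (k : ℝ) / ε⌉₊ ∧
      frobSqErrIn A (A.submatrix id f) k ≤ (1 + ε) * frobSqErr A k := by
  have hk0 : (0 : ℝ) < k := by exact_mod_cast (by omega : 0 < k)
  set s := ⌈3 * (k : ℝ) / ε⌉₊
  have hs0 : 0 < s := Nat.ceil_pos.2 (by positivity)
  have hsε : 3 * (k : ℝ) / s ≤ ε := by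
    rw [div_le_iff₀ (by exact_mod_cast hs0), ← div_le_iff₀' hε0]
    exact Nat.le_ceil _
  let ι := Σ r : Fin (100 * k + s + 1), (Fin r → Fin n)
  by_contra! hcon
  let φ : ι → ℝ := fun f => frobSqErrIn A (A.submatrix id f.2) k
  have : Nonempty ι := ⟨⟨0, Fin.elim0⟩⟩
  obtain ⟨f, hf⟩ := Finite.exists_min φ
  have hlt : frobSqErr A k < φ f / (1 + ε) := by
    rw [lt_div_iff₀ (by linarith), mul_comm]
    exact hcon f.1 f.2 (by have := f.1.2; omega)
  obtain ⟨_, ⟨X, hX, rfl⟩, hXlt⟩ := exists_lt_of_csInf_lt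
    (s := {e : ℝ | ∃ X : Matrix (Fin m) (Fin n) ℝ, X.rank ≤ k ∧ e = frobSq (A - X)})
    ⟨_, 0, by simp, rfl⟩ hlt
  obtain ⟨r, g, hr, hg⟩ := exists_frobSqErrIn_le A X hX hs0 hsε
  have hmin := hf ⟨⟨r, by omega⟩, g⟩
  rw [lt_div_iff₀ (by linarith), mul_comm] at hXlt
  exact (hmin.trans hg).not_gt hXlt
end
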